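/- arXiv:1009.1061 — 4 statements merged into one kernel-verified Lean document; each statement's English description precedes it below -/
import Mathlib

section
/- Let 0 < ε < 1, let k, m be positive integers, and let v_1, …, v_m be column vectors in ℝ^k with A = Σ_{i=1}^m v_i v_iᵀ. Then there exist nonnegative real weights s_1, …, s_m, at most ⌈k/ε²⌉ of which are nonzero, such that, setting Ã = Σ_{i=1}^m s_i v_i v_iᵀ, one has xᵀAx ≤ xᵀÃx ≤ ((1+ε)/(1−ε))² · xᵀAx for all x ∈ ℝ^k. -/
open Matrix

/-- `M` is positive definite and the trace of its inverse is at most `c`. -/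
def BSSGood {ι : Type*} [Fintype ι] [DecidableEq ι] (M : Matrix ι ι ℝ) (c : ℝ) : Prop :=
  M.PosDef ∧ M⁻¹.trace ≤ c

lemma bss_good_conj {ι : Type*} [Fintype ι] [DecidableEq ι] (M V : Matrix ι ι ℝ) (c : ℝ)
    (h1 : V * Vᵀ = 1) (h2 : Vᵀ * V = 1) (h : BSSGood M c) : BSSGood (Vᵀ * M * V) c := by
  obtain ⟨hp, ht⟩ := h
  constructor
  · have := hp.conjTranspose_mul_mul_same (B := V) (by
      intro x y hxy
      have := congrArg (fun z => Vᵀ *ᵥ z) hxy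
      simpa [Matrix.mulVec_mulVec, h2] using this)
    simpa [Matrix.conjTranspose_eq_transpose_of_trivial] using this
  · have hu : M * M⁻¹ = 1 := Matrix.mul_nonsing_inv M ((Matrix.isUnit_iff_isUnit_det M).1 hp.isUnit)
    have : (Vᵀ * M * V)⁻¹ = Vᵀ * M⁻¹ * V := by
      apply Matrix.inv_eq_right_inv
      calc Vᵀ * M * V * (Vᵀ * M⁻¹ * V) = Vᵀ * (M * (V * Vᵀ) * M⁻¹) * V := by
            simp only [Matrix.mul_assoc]
        _ = 1 := by rw [h1, Matrix.mul_one, hu, Matrix.mul_one, h2]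
    rw [this, Matrix.trace_mul_cycle, h1, Matrix.one_mul]
    exact ht

lemma bss_good_diagonal {ι : Type*} [Fintype ι] [DecidableEq ι] (d : ι → ℝ) (c : ℝ) :
    BSSGood (diagonal d) c ↔ (∀ i, 0 < d i) ∧ ∑ i, 1 / d i ≤ c := by
  unfold BSSGood
  rw [Matrix.posDef_diagonal_iff]
  refine and_congr_right fun h => ?_
  have : (diagonal d)⁻¹ = diagonal (fun i => 1 / d i) := by
    apply Matrix.inv_eq_right_inv
    rw [Matrix.diagonal_mul_diagonal, ← Matrix.diagonal_one]
    congr 1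
    funext i
    have := (h i).ne'
    field_simp
  rw [this, Matrix.trace_diagonal]

/-- Rank-one update of a positive diagonal matrix. -/
lemma bss_rank_one {ι : Type*} [Fintype ι] [DecidableEq ι] (d v : ι → ℝ) (c b : ℝ)
    (hd : ∀ i, 0 < d i) (h : 0 < 1 + c * ∑ j, v j ^ 2 / d j)
    (hb : ∑ j, 1 / d j - c / (1 + c * ∑ j, v j ^ 2 / d j) * ∑ j, v j ^ 2 / d j ^ 2 ≤ b) :
    BSSGood (diagonal d + c • vecMulVec v v) b := by
  set q := ∑ j, v j ^ 2 / d j with hq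
  constructor
  · apply Matrix.PosDef.of_dotProduct_mulVec_pos
    · ext i j
      simp [Matrix.vecMulVec_apply, Matrix.diagonal_apply, mul_comm, eq_comm]
      split_ifs with hij
      · rw [hij]
      · rfl
    · intro x hx
      have e : star x ⬝ᵥ (diagonal d + c • vecMulVec v v) *ᵥ x
          = ∑ j, d j * x j ^ 2 + c * (∑ j, v j * x j) ^ 2 := by
        rw [Matrix.add_mulVec, dotProduct_add, Matrix.smul_mulVec, dotProduct_smul,
          Matrix.vecMulVec_mulVec]
        simp only [star_trivial, dotProduct_smul, smul_eq_mul, op_smul_eq_smul]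
        congr 1
        · simp only [dotProduct, Matrix.mulVec_diagonal]
          exact Finset.sum_congr rfl fun j _ => by ring
        · rw [dotProduct_comm x v]; simp only [dotProduct]; ring
      rw [e]
      have cs : (∑ j, v j * x j) ^ 2 ≤ q * ∑ j, d j * x j ^ 2 := by
        apply Finset.sum_sq_le_sum_mul_sum_of_sq_le_mul
        · intro i _; have := hd i; positivity
        · intro i _; have := hd i; positivity
        · intro i _
          have := (hd i).ne'
          apply le_of_eq
          field_simp
      have hpos : 0 < ∑ j, d j * x j ^ 2 := by
        obtain ⟨j, hj⟩ := Function.ne_iff.1 hx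
        apply Finset.sum_pos'
        · intro i _; have := hd i; positivity
        · refine ⟨j, Finset.mem_univ _, ?_⟩
          have := hd j
          have hj' : x j ≠ 0 := hj
          positivity
      rcases le_or_gt 0 c with hc | hc
      · have : 0 ≤ c * (∑ j, v j * x j) ^ 2 := by positivity
        linarith
      · have := mul_pos h hpos
        nlinarith
  · have : (diagonal d + c • vecMulVec v v)⁻¹ = diagonal (fun i => 1 / d i) -
        (c / (1 + c * q)) • vecMulVec (fun i => v i / d i) (fun i => v i / d i) := by
      apply Matrix.inv_eq_right_inv
      ext i j
      have hdi := (hd i).ne'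
      have hdj := (hd j).ne'
      have e1 : v ⬝ᵥ (fun i => v i / d i) = q := by
        simp only [dotProduct, hq]
        exact Finset.sum_congr rfl fun j _ => by ring
      rw [Matrix.mul_sub, Matrix.add_mul, Matrix.add_mul, Matrix.diagonal_mul_diagonal,
        Matrix.smul_mul, Matrix.smul_mul, Matrix.mul_smul, Matrix.mul_smul,
        Matrix.vecMulVec_mul_vecMulVec, e1]
      simp only [Matrix.add_apply, Matrix.sub_apply, Matrix.smul_apply, Matrix.diagonal_mul,
        Matrix.mul_diagonal, Matrix.vecMulVec_apply, Matrix.diagonal_apply, Matrix.one_apply,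
        smul_eq_mul, Pi.smul_apply]
      have h' := h.ne'
      by_cases hij : i = j
      · subst hij
        simp only [if_true]
        field_simp
        ring
      · simp only [hij, if_false]
        field_simp
        ring
    rw [this, Matrix.trace_sub, Matrix.trace_smul, Matrix.trace_vecMulVec, Matrix.trace_diagonal]
    refine le_trans (le_of_eq ?_) hb
    congr 1
    rw [smul_eq_mul]
    congr 1
    simp only [dotProduct]
    exact Finset.sum_congr rfl fun j _ => by ring

/-- Upper averaging. -/
lemma bss_upper_avg {ι : Type*} [Fintype ι] [Nonempty ι] (a : ι → ℝ) (δ c : ℝ) (hδ : 0 < δ)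
    (ha : ∀ j, 0 < a j) (hc : ∑ j, 1 / a j ≤ c) :
    0 < ∑ j, 1 / a j - ∑ j, 1 / (a j + δ) ∧
    (∑ j, 1 / (a j + δ) ^ 2) / (∑ j, 1 / a j - ∑ j, 1 / (a j + δ)) + ∑ j, 1 / (a j + δ)
      ≤ 1 / δ + c := by
  have hlt : ∀ j, 1 / (a j + δ) < 1 / a j := fun j =>
    one_div_lt_one_div_of_lt (ha j) (by linarith)
  have h0 : 0 < ∑ j, 1 / a j - ∑ j, 1 / (a j + δ) :=
    sub_pos.2 (Finset.sum_lt_sum_of_nonempty Finset.univ_nonempty fun j _ => hlt j)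
  refine ⟨h0, ?_⟩
  have h1 : (∑ j, 1 / (a j + δ) ^ 2) / (∑ j, 1 / a j - ∑ j, 1 / (a j + δ)) ≤ 1 / δ := by
    rw [div_le_div_iff₀ h0 hδ, one_mul, ← Finset.sum_sub_distrib, Finset.sum_mul]
    apply Finset.sum_le_sum
    intro j _
    have := ha j
    rw [show 1 / a j - 1 / (a j + δ) = δ / (a j * (a j + δ)) by field_simp; ring,
      div_mul_eq_mul_div, one_mul]
    apply div_le_div_of_nonneg_left hδ.le (by positivity)
    nlinarith
  have h2 : ∑ j, 1 / (a j + δ) ≤ ∑ j, 1 / a j := by linarith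
  linarith

/-- Lower averaging. -/
lemma bss_lower_avg {ι : Type*} [Fintype ι] [Nonempty ι] (a : ι → ℝ) (c : ℝ) (hc1 : c < 1)
    (ha : ∀ j, 0 < a j) (hc : ∑ j, 1 / a j ≤ c) :
    (∀ j, 0 < a j - 1) ∧ 0 < ∑ j, 1 / (a j - 1) - ∑ j, 1 / a j ∧
    1 - c ≤ (∑ j, 1 / (a j - 1) ^ 2) / (∑ j, 1 / (a j - 1) - ∑ j, 1 / a j)
      - ∑ j, 1 / (a j - 1) := by
  have hb : ∀ j, 0 < a j - 1 := by
    intro j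
    have h1 : 1 / a j ≤ ∑ j, 1 / a j :=
      Finset.single_le_sum (f := fun j => 1 / a j)
        (fun i _ => (one_div_pos.2 (ha i)).le) (Finset.mem_univ j)
    have h2 : 1 / a j < 1 := by linarith
    rw [div_lt_one (ha j)] at h2
    linarith
  have hlt : ∀ j, 1 / a j < 1 / (a j - 1) := fun j =>
    one_div_lt_one_div_of_lt (hb j) (by linarith)
  have h0 : 0 < ∑ j, 1 / (a j - 1) - ∑ j, 1 / a j :=
    sub_pos.2 (Finset.sum_lt_sum_of_nonempty Finset.univ_nonempty fun j _ => hlt j)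
  refine ⟨hb, h0, ?_⟩
  set D := ∑ j, 1 / (a j - 1) - ∑ j, 1 / a j with hD
  have hDs : D = ∑ j, 1 / (a j * (a j - 1)) := by
    rw [hD, ← Finset.sum_sub_distrib]
    refine Finset.sum_congr rfl fun j _ => ?_
    have h1 := (ha j).ne'
    have h2 := (hb j).ne'
    field_simp
    ring
  have hT : (∑ j, 1 / (a j - 1) ^ 2) = D + ∑ j, 1 / (a j * (a j - 1) ^ 2) := by
    rw [hDs, ← Finset.sum_add_distrib]
    refine Finset.sum_congr rfl fun j _ => ?_
    have h1 := (ha j).ne'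
    have h2 := (hb j).ne'
    field_simp
    ring
  have cs : D ^ 2 ≤ (∑ j, 1 / (a j * (a j - 1) ^ 2)) * ∑ j, 1 / a j := by
    rw [hDs]
    apply Finset.sum_sq_le_sum_mul_sum_of_sq_le_mul
    · intro i _; have := ha i; positivity
    · intro i _; have := ha i; positivity
    · intro i _
      apply le_of_eq
      have h1 := (ha i).ne'
      have h2 := (hb i).ne'
      field_simp
  have hTn : 0 ≤ ∑ j, 1 / (a j * (a j - 1) ^ 2) :=
    Finset.sum_nonneg fun i _ => by have := ha i; positivity
  have hkey : D * (1 + D) ≤ ∑ j, 1 / (a j - 1) ^ 2 := by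
    rw [hT]; nlinarith
  have : 1 + D ≤ (∑ j, 1 / (a j - 1) ^ 2) / D := by
    rw [le_div_iff₀ h0]; linarith
  linarith

lemma bss_weighted_sum {ι κ : Type*} [Fintype ι] [Fintype κ] (w : κ → ι → ℝ)
    (hw : ∀ j, ∑ i, w i j ^ 2 = 1) (g : ι → ℝ) :
    ∑ i, ∑ j, w i j ^ 2 / g j = ∑ j, 1 / g j := by
  rw [Finset.sum_comm]
  refine Finset.sum_congr rfl fun j _ => ?_
  rw [← Finset.sum_div, hw]

lemma bss_diag_step {ι κ : Type*} [Fintype ι] [Nonempty ι] [DecidableEq ι] [Fintype κ]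
    (w : κ → ι → ℝ) (hw : ∀ j, ∑ i, w i j ^ 2 = 1) (lam : ι → ℝ) (l u δ cu cl : ℝ)
    (hδ : 0 < δ) (hcl : cl < 1) (hcc : 1 / δ + cu ≤ 1 - cl)
    (hu : BSSGood (diagonal fun j => u - lam j) cu)
    (hl : BSSGood (diagonal fun j => lam j - l) cl) :
    ∃ i : κ, ∃ t : ℝ, 0 < t ∧
      BSSGood ((diagonal fun j => u - lam j + δ) + (-t) • vecMulVec (w i) (w i)) cu ∧
      BSSGood ((diagonal fun j => lam j - l - 1) + t • vecMulVec (w i) (w i)) cl := by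
  rw [bss_good_diagonal] at hu hl
  obtain ⟨hu0, huc⟩ := hu
  obtain ⟨hl0, hlc⟩ := hl
  obtain ⟨hD, hU⟩ := bss_upper_avg (fun j => u - lam j) δ cu hδ hu0 huc
  obtain ⟨hl1, hE, hL⟩ := bss_lower_avg (fun j => lam j - l) cl hcl hl0 hlc
  have hu1 : ∀ j, 0 < u - lam j + δ := fun j => by have := hu0 j; linarith
  set D := ∑ j, 1 / (u - lam j) - ∑ j, 1 / (u - lam j + δ) with hDdef
  set E := ∑ j, 1 / (lam j - l - 1) - ∑ j, 1 / (lam j - l) with hEdef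
  set p : κ → ℝ := fun i => ∑ j, w i j ^ 2 / (u - lam j + δ) ^ 2 with hp
  set q : κ → ℝ := fun i => ∑ j, w i j ^ 2 / (u - lam j + δ) with hq
  set p' : κ → ℝ := fun i => ∑ j, w i j ^ 2 / (lam j - l - 1) ^ 2 with hp'
  set q' : κ → ℝ := fun i => ∑ j, w i j ^ 2 / (lam j - l - 1) with hq'
  have hpn : ∀ i, 0 ≤ p i := fun i => Finset.sum_nonneg fun j _ => by positivity
  have hqn : ∀ i, 0 ≤ q i := fun i => Finset.sum_nonneg fun j _ => by
    have := hu1 j; positivity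
  have hq'n : ∀ i, 0 ≤ q' i := fun i => Finset.sum_nonneg fun j _ => by
    have := hl1 j; positivity
  have sU : ∑ i, (p i / D + q i) ≤ 1 / δ + cu := by
    rw [Finset.sum_add_distrib, ← Finset.sum_div, hp, hq, bss_weighted_sum w hw,
      bss_weighted_sum w hw]
    exact hU
  have sL : 1 - cl ≤ ∑ i, (p' i / E - q' i) := by
    rw [Finset.sum_sub_distrib, ← Finset.sum_div, hp', hq', bss_weighted_sum w hw,
      bss_weighted_sum w hw]
    exact hL
  obtain ⟨i, hiL, hi⟩ : ∃ i, 0 < p' i / E - q' i ∧ p i / D + q i ≤ p' i / E - q' i := by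
    by_contra hcon
    push Not at hcon
    have hUn : ∀ i, 0 ≤ p i / D + q i := fun i =>
      add_nonneg (div_nonneg (hpn i) hD.le) (hqn i)
    obtain ⟨i0, _, hi0⟩ : ∃ i ∈ Finset.univ, 0 < p' i / E - q' i := by
      apply Finset.exists_lt_of_sum_lt
      simp only [Finset.sum_const_zero]
      linarith
    have : ∑ i, (p' i / E - q' i) < ∑ i, (p i / D + q i) := by
      apply Finset.sum_lt_sum
      · intro i _
        rcases le_or_gt (p' i / E - q' i) 0 with h | h
        · exact h.trans (hUn i)
        · exact (hcon i h).le
      · exact ⟨i0, Finset.mem_univ _, hcon i0 hi0⟩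
    linarith
  have hp'pos : 0 < p' i := by
    by_contra hcon
    have h1 : p' i / E ≤ 0 := div_nonpos_of_nonpos_of_nonneg (not_lt.1 hcon) hE.le
    have := hq'n i
    linarith
  have hppos : 0 < p i := by
    obtain ⟨j, _, hj⟩ : ∃ j ∈ Finset.univ, w i j ^ 2 / (lam j - l - 1) ^ 2 ≠ 0 :=
      Finset.exists_ne_zero_of_sum_ne_zero hp'pos.ne'
    have hwj : w i j ≠ 0 := by
      rintro h
      apply hj
      rw [h]; simp
    apply Finset.sum_pos'
    · intro j _; positivity
    · refine ⟨j, Finset.mem_univ _, ?_⟩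
      have := hu1 j
      positivity
  set R := p' i / E - q' i with hR
  have hpD : 0 < p i / D := div_pos hppos hD
  refine ⟨i, 1 / R, one_div_pos.2 hiL, ?_, ?_⟩
  · have hqR : 0 < R - q i := by linarith
    have e : 1 + -(1 / R) * q i = (R - q i) / R := by field_simp; ring
    apply bss_rank_one _ _ _ _ hu1
    · change 0 < 1 + -(1 / R) * q i
      rw [e]; positivity
    · change ∑ j, 1 / (u - lam j + δ) - -(1 / R) / (1 + -(1 / R) * q i) * p i ≤ cu
      rw [e]
      have e2 : -(1 / R) / ((R - q i) / R) * p i = - (p i / (R - q i)) := by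
        field_simp
      rw [e2]
      have : p i / (R - q i) ≤ D := by
        rw [div_le_iff₀ hqR]
        have : p i / D ≤ R - q i := by linarith
        rw [div_le_iff₀ hD] at this
        linarith
      linarith
  · have hq'i := hq'n i
    have hqR : 0 < R + q' i := by linarith
    have e : 1 + (1 / R) * q' i = (R + q' i) / R := by field_simp
    apply bss_rank_one _ _ _ _ hl1
    · change 0 < 1 + (1 / R) * q' i
      rw [e]; positivity
    · change ∑ j, 1 / (lam j - l - 1) - (1 / R) / (1 + (1 / R) * q' i) * p' i ≤ cl
      rw [e]
      have e2 : (1 / R) / ((R + q' i) / R) * p' i = p' i / (R + q' i) := by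
        field_simp
      rw [e2]
      have h3 : R + q' i = p' i / E := by rw [hR]; ring
      have : p' i / (R + q' i) = E := by
        rw [h3]; field_simp
      rw [this]
      linarith

lemma bss_step {ι κ : Type*} [Fintype ι] [Nonempty ι] [DecidableEq ι] [Fintype κ]
    (w : κ → ι → ℝ) (hw : ∑ i, vecMulVec (w i) (w i) = 1) (S : Matrix ι ι ℝ)
    (hS : S.IsHermitian) (l u δ cu cl : ℝ)
    (hδ : 0 < δ) (hcl : cl < 1) (hcc : 1 / δ + cu ≤ 1 - cl)
    (hu : BSSGood (u • 1 - S) cu) (hl : BSSGood (S - l • 1) cl) :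
    ∃ i : κ, ∃ t : ℝ, 0 < t ∧
      BSSGood ((u + δ) • 1 - (S + t • vecMulVec (w i) (w i))) cu ∧
      BSSGood ((S + t • vecMulVec (w i) (w i)) - (l + 1) • 1) cl := by
  obtain ⟨V, lam, h1, h2, hSV⟩ : ∃ (V : Matrix ι ι ℝ) (lam : ι → ℝ), V * Vᵀ = 1 ∧ Vᵀ * V = 1 ∧
      S = V * diagonal lam * Vᵀ := by
    refine ⟨hS.eigenvectorUnitary, hS.eigenvalues, ?_, ?_, ?_⟩
    · exact Unitary.coe_mul_star_self hS.eigenvectorUnitary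
    · exact Unitary.coe_star_mul_self hS.eigenvectorUnitary
    · exact hS.spectral_theorem
  have conj1 : Vᵀ * S * V = diagonal lam := by
    rw [hSV]
    calc Vᵀ * (V * diagonal lam * Vᵀ) * V = (Vᵀ * V) * diagonal lam * (Vᵀ * V) := by
          simp only [Matrix.mul_assoc]
      _ = _ := by rw [h2, Matrix.one_mul, Matrix.mul_one]
  have hsm : ∀ c : ℝ, Vᵀ * (c • (1 : Matrix ι ι ℝ)) * V = diagonal fun _ => c := by
    intro c
    rw [Matrix.mul_smul, Matrix.smul_mul, Matrix.mul_one, h2, Matrix.smul_one_eq_diagonal]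
  have hsm' : ∀ c : ℝ, V * (diagonal fun _ => c) * Vᵀ = c • (1 : Matrix ι ι ℝ) := by
    intro c
    rw [← Matrix.smul_one_eq_diagonal, Matrix.mul_smul, Matrix.smul_mul, Matrix.mul_one, h1]
  have hvv : ∀ i, V * vecMulVec (Vᵀ *ᵥ w i) (Vᵀ *ᵥ w i) * Vᵀ = vecMulVec (w i) (w i) := by
    intro i
    rw [Matrix.mul_vecMulVec, Matrix.vecMulVec_mul, Matrix.mulVec_mulVec, h1,
      Matrix.vecMul_transpose, Matrix.mulVec_mulVec, h1, Matrix.one_mulVec]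
  have hww : ∑ i, vecMulVec (Vᵀ *ᵥ w i) (Vᵀ *ᵥ w i) = 1 := by
    have : ∀ i, vecMulVec (Vᵀ *ᵥ w i) (Vᵀ *ᵥ w i) = Vᵀ * vecMulVec (w i) (w i) * V := by
      intro i
      rw [Matrix.mul_vecMulVec, Matrix.vecMulVec_mul, Matrix.mulVec_transpose]
    simp_rw [this]
    rw [← Finset.sum_mul, ← Finset.mul_sum, hw, Matrix.mul_one, h2]
  have hw' : ∀ j, ∑ i, (Vᵀ *ᵥ w i) j ^ 2 = 1 := by
    intro j
    have := congrFun (congrFun hww j) j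
    rw [Matrix.sum_apply] at this
    simpa [Matrix.vecMulVec_apply, pow_two] using this
  have hu' := bss_good_conj _ V _ h1 h2 hu
  have hl' := bss_good_conj _ V _ h1 h2 hl
  rw [Matrix.mul_sub, Matrix.sub_mul, conj1, hsm, Matrix.diagonal_sub] at hu' hl'
  obtain ⟨i, t, ht, hU, hL⟩ := bss_diag_step (fun i => Vᵀ *ᵥ w i) hw' lam l u δ cu cl hδ hcl hcc
    hu' hl'
  refine ⟨i, t, ht, ?_, ?_⟩
  · have := bss_good_conj _ Vᵀ _ (by simpa using h2) (by simpa using h1) hU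
    convert this using 1
    rw [Matrix.transpose_transpose, Matrix.mul_add, Matrix.add_mul, Matrix.mul_smul,
      Matrix.smul_mul, hvv, hSV, ← hsm' (u + δ)]
    have : (diagonal fun j => u - lam j + δ) = (diagonal fun _ => u + δ) - diagonal lam := by
      rw [Matrix.diagonal_sub]; congr 1; funext j; ring
    rw [this, Matrix.mul_sub, Matrix.sub_mul, neg_smul]
    abel
  · have := bss_good_conj _ Vᵀ _ (by simpa using h2) (by simpa using h1) hL
    convert this using 1
    rw [Matrix.transpose_transpose, Matrix.mul_add, Matrix.add_mul, Matrix.mul_smul,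
      Matrix.smul_mul, hvv, hSV, ← hsm' (l + 1)]
    have : (diagonal fun j => lam j - l - 1) = diagonal lam - (diagonal fun _ => l + 1) := by
      rw [Matrix.diagonal_sub]; congr 1; funext j; ring
    rw [this, Matrix.mul_sub, Matrix.sub_mul]
    abel

lemma bss_quad {ι κ : Type*} [Fintype ι] [Fintype κ] (w : κ → ι → ℝ) (s : κ → ℝ) (x : ι → ℝ) :
    x ⬝ᵥ (∑ i, s i • vecMulVec (w i) (w i)) *ᵥ x = ∑ i, s i * (w i ⬝ᵥ x) ^ 2 := by
  rw [Matrix.sum_mulVec, dotProduct_sum]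
  refine Finset.sum_congr rfl fun i _ => ?_
  rw [Matrix.smul_mulVec, dotProduct_smul, Matrix.vecMulVec_mulVec, op_smul_eq_smul,
    dotProduct_smul, dotProduct_comm x, smul_eq_mul, smul_eq_mul, pow_two]

lemma bss_loop {ι κ : Type*} [Fintype ι] [Nonempty ι] [DecidableEq ι] [Fintype κ] [DecidableEq κ]
    (w : κ → ι → ℝ) (hw : ∑ i, vecMulVec (w i) (w i) = 1) (e : ℝ) (he0 : 0 < e) (he1 : e < 1)
    (Q : ℕ) :
    ∃ s : κ → ℝ, (∀ i, 0 ≤ s i) ∧ (Finset.univ.filter (fun i => s i ≠ 0)).card ≤ Q ∧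
      BSSGood (((1 + e) / (1 - e) * (Q + Fintype.card ι / e)) • 1
        - ∑ i, s i • vecMulVec (w i) (w i)) (e * (1 - e) / (1 + e)) ∧
      BSSGood ((∑ i, s i • vecMulVec (w i) (w i)) - ((Q : ℝ) - Fintype.card ι / e) • 1) e := by
  have hn : (0 : ℝ) < Fintype.card ι := by exact_mod_cast Fintype.card_pos
  have h1e : 0 < 1 - e := by linarith
  induction Q with
  | zero =>
    refine ⟨fun _ => 0, fun _ => le_rfl, by simp, ?_, ?_⟩
    · simp only [zero_smul, Finset.sum_const_zero, sub_zero, Matrix.smul_one_eq_diagonal]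
      rw [bss_good_diagonal]
      refine ⟨fun _ => by positivity, le_of_eq ?_⟩
      simp only [Finset.sum_const, Finset.card_univ, nsmul_eq_mul, Nat.cast_zero, zero_add]
      field_simp
    · simp only [zero_smul, Finset.sum_const_zero, zero_sub,
        Matrix.smul_one_eq_diagonal, Matrix.diagonal_neg]
      rw [bss_good_diagonal]
      simp only [Nat.cast_zero, zero_sub, neg_neg]
      refine ⟨fun _ => by positivity, le_of_eq ?_⟩
      simp only [Finset.sum_const, Finset.card_univ, nsmul_eq_mul]
      field_simp
  | succ Q ih =>
    obtain ⟨s, hs0, hsc, hU, hL⟩ := ih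
    have hS : (∑ i, s i • vecMulVec (w i) (w i)).IsHermitian := by
      ext a b
      simp [Matrix.sum_apply, Matrix.vecMulVec_apply, mul_comm]
    obtain ⟨i, t, ht, hU', hL'⟩ := bss_step w hw _ hS _ _ ((1 + e) / (1 - e)) _ _
      (by positivity) he1 (le_of_eq (by field_simp)) hU hL
    have hsum : ∑ a, (s + Pi.single i t : κ → ℝ) a • vecMulVec (w a) (w a)
        = (∑ a, s a • vecMulVec (w a) (w a)) + t • vecMulVec (w i) (w i) := by
      simp only [Pi.add_apply, add_smul, Finset.sum_add_distrib]
      congr 1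
      rw [Finset.sum_eq_single i]
      · simp
      · intro b _ hb; simp [Pi.single_eq_of_ne hb]
      · simp
    refine ⟨s + Pi.single i t, ?_, ?_, ?_, ?_⟩
    · intro a
      by_cases h : a = i
      · subst h; simp only [Pi.add_apply, Pi.single_eq_same]; linarith [hs0 a]
      · simpa [Pi.single_eq_of_ne h] using hs0 a
    · have hsub : Finset.univ.filter (fun a => (s + Pi.single i t : κ → ℝ) a ≠ 0) ⊆
          insert i (Finset.univ.filter (fun a => s a ≠ 0)) := by
        intro a ha
        by_cases h : a = i
        · simp [h]
        · simpa [Pi.single_eq_of_ne h, h] using ha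
      exact (Finset.card_le_card hsub).trans ((Finset.card_insert_le _ _).trans (by omega))
    · rw [hsum]
      convert hU' using 3
      push_cast; ring
    · rw [hsum]
      convert hL' using 3
      push_cast; ring

lemma bss_identity {ι κ : Type*} [Fintype ι] [Nonempty ι] [DecidableEq ι] [Fintype κ]
    [DecidableEq κ]
    (w : κ → ι → ℝ) (hw : ∑ i, vecMulVec (w i) (w i) = 1) (e : ℝ) (he0 : 0 < e) (he1 : e < 1)
    (Q : ℕ) (hQ : (Fintype.card ι : ℝ) / e ^ 2 ≤ Q) :
    ∃ s : κ → ℝ, (∀ i, 0 ≤ s i) ∧ (Finset.univ.filter (fun i => s i ≠ 0)).card ≤ Q ∧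
      ∀ y : ι → ℝ, y ⬝ᵥ y ≤ ∑ i, s i * (w i ⬝ᵥ y) ^ 2 ∧
        ∑ i, s i * (w i ⬝ᵥ y) ^ 2 ≤ ((1 + e) / (1 - e)) ^ 2 * (y ⬝ᵥ y) := by
  obtain ⟨s, hs0, hsc, hU, hL⟩ := bss_loop w hw e he0 he1 Q
  have hn : (0 : ℝ) < Fintype.card ι := by exact_mod_cast Fintype.card_pos
  have h1e : 0 < 1 - e := by linarith
  set n : ℝ := (Fintype.card ι : ℝ)
  have hQe : n / e ≤ e * Q := by
    rw [div_le_iff₀ (by positivity)] at hQ ⊢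
    nlinarith
  have hQ0 : (0 : ℝ) < Q := lt_of_lt_of_le (by positivity) hQ
  set l : ℝ := Q - n / e with hl
  have hl0 : 0 < l := by
    have : 0 < (1 - e) * Q := by positivity
    linarith
  set u : ℝ := (1 + e) / (1 - e) * (Q + n / e) with hu
  have hul : u ≤ ((1 + e) / (1 - e)) ^ 2 * l := by
    rw [hu, pow_two, mul_assoc]
    apply mul_le_mul_of_nonneg_left _ (by positivity)
    rw [div_mul_eq_mul_div, le_div_iff₀ h1e]
    nlinarith
  refine ⟨fun i => s i / l, fun i => div_nonneg (hs0 i) hl0.le, ?_, ?_⟩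
  · refine le_trans (Finset.card_le_card ?_) hsc
    intro i hi
    simp only [Finset.mem_filter, Finset.mem_univ, true_and] at hi ⊢
    intro h
    exact hi (by rw [h, zero_div])
  · intro y
    have hyU := hU.1.posSemidef.dotProduct_mulVec_nonneg y
    have hyL := hL.1.posSemidef.dotProduct_mulVec_nonneg y
    rw [Matrix.sub_mulVec, dotProduct_sub, star_trivial, bss_quad, Matrix.smul_mulVec,
      Matrix.one_mulVec, dotProduct_smul, smul_eq_mul] at hyU hyL
    have e1 : ∑ i, s i / l * (w i ⬝ᵥ y) ^ 2 = (∑ i, s i * (w i ⬝ᵥ y) ^ 2) / l := by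
      rw [Finset.sum_div]
      exact Finset.sum_congr rfl fun i _ => by ring
    have hyy : 0 ≤ y ⬝ᵥ y := by
      simp only [dotProduct]
      exact Finset.sum_nonneg fun i _ => mul_self_nonneg _
    rw [e1, le_div_iff₀ hl0, div_le_iff₀ hl0]
    constructor
    · linarith
    · have := mul_le_mul_of_nonneg_right hul hyy
      linarith

/-- Reduction to the isotropic case on the nonzero eigenspaces. -/
lemma bss_reduce (k m : ℕ) (v : Fin m → (Fin k → ℝ)) :
    ∃ (p : Fin k → Prop) (_ : DecidablePred p) (w : Fin m → ({j // p j} → ℝ))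
      (y : (Fin k → ℝ) → ({j // p j} → ℝ)),
      (∑ i, vecMulVec (w i) (w i) = 1) ∧
      (∀ i x, v i ⬝ᵥ x = w i ⬝ᵥ y x) := by
  classical
  set A : Matrix (Fin k) (Fin k) ℝ := ∑ i, vecMulVec (v i) (v i) with hA
  have hS : A.IsHermitian := by
    ext a b
    simp [hA, Matrix.sum_apply, Matrix.vecMulVec_apply, mul_comm]
  obtain ⟨V, lam, h1, h2, hSV⟩ : ∃ (V : Matrix (Fin k) (Fin k) ℝ) (lam : Fin k → ℝ),
      V * Vᵀ = 1 ∧ Vᵀ * V = 1 ∧ A = V * diagonal lam * Vᵀ := by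
    refine ⟨hS.eigenvectorUnitary, hS.eigenvalues, ?_, ?_, ?_⟩
    · exact Unitary.coe_mul_star_self hS.eigenvectorUnitary
    · exact Unitary.coe_star_mul_self hS.eigenvectorUnitary
    · exact hS.spectral_theorem
  have conj1 : Vᵀ * A * V = diagonal lam := by
    rw [hSV]
    calc Vᵀ * (V * diagonal lam * Vᵀ) * V = (Vᵀ * V) * diagonal lam * (Vᵀ * V) := by
          simp only [Matrix.mul_assoc]
      _ = _ := by rw [h2, Matrix.one_mul, Matrix.mul_one]
  have hww : ∑ i, vecMulVec (Vᵀ *ᵥ v i) (Vᵀ *ᵥ v i) = diagonal lam := by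
    have : ∀ i, vecMulVec (Vᵀ *ᵥ v i) (Vᵀ *ᵥ v i) = Vᵀ * vecMulVec (v i) (v i) * V := by
      intro i
      rw [Matrix.mul_vecMulVec, Matrix.vecMulVec_mul, Matrix.mulVec_transpose]
    simp_rw [this]
    rw [← Finset.sum_mul, ← Finset.mul_sum, ← hA, conj1]
  have hent : ∀ a b, ∑ i, (Vᵀ *ᵥ v i) a * (Vᵀ *ᵥ v i) b = diagonal lam a b := by
    intro a b
    rw [← hww, Matrix.sum_apply]
    rfl
  have hlam : ∀ a, lam a = ∑ i, (Vᵀ *ᵥ v i) a ^ 2 := by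
    intro a
    have := hent a a
    rw [Matrix.diagonal_apply_eq] at this
    rw [← this]
    exact Finset.sum_congr rfl fun i _ => by ring
  have hlam0 : ∀ a, 0 ≤ lam a := fun a => by
    rw [hlam]; exact Finset.sum_nonneg fun i _ => sq_nonneg _
  have hz : ∀ a, ¬ (0 < lam a) → ∀ i, (Vᵀ *ᵥ v i) a = 0 := by
    intro a ha i
    have h0 : ∑ i, (Vᵀ *ᵥ v i) a ^ 2 = 0 := by
      rw [← hlam]; exact le_antisymm (not_lt.1 ha) (hlam0 a)
    rw [Finset.sum_eq_zero_iff_of_nonneg fun i _ => sq_nonneg _] at h0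
    exact pow_eq_zero_iff (two_ne_zero) |>.1 (h0 i (Finset.mem_univ _))
  refine ⟨fun j => 0 < lam j, inferInstance, fun i j => (Vᵀ *ᵥ v i) j / √(lam j),
    fun x j => √(lam j) * (Vᵀ *ᵥ x) j, ?_, ?_⟩
  · ext ⟨a, ha⟩ ⟨b, hb⟩
    rw [Matrix.sum_apply]
    simp only [Matrix.vecMulVec_apply]
    have : ∑ i, (Vᵀ *ᵥ v i) a / √(lam a) * ((Vᵀ *ᵥ v i) b / √(lam b))
        = (diagonal lam a b) / (√(lam a) * √(lam b)) := by
      rw [← hent, Finset.sum_div]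
      exact Finset.sum_congr rfl fun i _ => by ring
    rw [this]
    by_cases hab : a = b
    · subst hab
      rw [Matrix.diagonal_apply_eq, Matrix.one_apply_eq, Real.mul_self_sqrt ha.le,
        div_self ha.ne']
    · rw [Matrix.diagonal_apply_ne _ hab, Matrix.one_apply_ne (by simpa using hab), zero_div]
  · intro i x
    have e1 : v i ⬝ᵥ x = (Vᵀ *ᵥ v i) ⬝ᵥ (Vᵀ *ᵥ x) := by
      rw [Matrix.dotProduct_mulVec, Matrix.vecMul_transpose, Matrix.mulVec_mulVec, h1,
        Matrix.one_mulVec]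
    rw [e1]
    simp only [dotProduct]
    rw [← Finset.sum_filter_of_ne (p := fun j => 0 < lam j)
      (fun j _ hj => by
        by_contra hcon
        exact hj (by rw [hz j hcon i, zero_mul]))]
    rw [Finset.sum_subtype (p := fun j => 0 < lam j) _ (by simp)]
    refine Finset.sum_congr rfl ?_
    rintro ⟨j, hj⟩ _
    have := (Real.sqrt_pos.2 hj).ne'
    simp only
    field_simp

/-- **Batson–Spielman–Srivastava sparsification theorem.**
Let `0 < ε < 1`, let `k, m` be positive integers, and let `v 1, …, v m` be column
vectors in `ℝ^k` with `A = ∑ i, vᵢ vᵢᵀ`.  Then there exist nonnegative weights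
`s 1, …, s m`, at most `⌈k / ε²⌉` of which are nonzero, such that, setting
`Ã = ∑ i, s i • vᵢ vᵢᵀ`, one has `xᵀAx ≤ xᵀÃx ≤ ((1+ε)/(1-ε))² xᵀAx` for all
`x ∈ ℝ^k`. -/
theorem bss_sparsification (k m : ℕ) (hk : 0 < k) (hm : 0 < m)
    (ε : ℝ) (hε0 : 0 < ε) (hε1 : ε < 1)
    (v : Fin m → (Fin k → ℝ))
    (A : Matrix (Fin k) (Fin k) ℝ)
    (hA : A = ∑ i, Matrix.vecMulVec (v i) (v i)) :
    ∃ s : Fin m → ℝ,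
      (∀ i, 0 ≤ s i) ∧
      (Finset.univ.filter (fun i => s i ≠ 0)).card ≤ ⌈(k : ℝ) / ε ^ 2⌉₊ ∧
      ∀ x : Fin k → ℝ,
        x ⬝ᵥ A.mulVec x ≤
          x ⬝ᵥ (∑ i, s i • Matrix.vecMulVec (v i) (v i)).mulVec x ∧
        x ⬝ᵥ (∑ i, s i • Matrix.vecMulVec (v i) (v i)).mulVec x ≤
          ((1 + ε) / (1 - ε)) ^ 2 * (x ⬝ᵥ A.mulVec x) := by
  obtain ⟨p, _, w, y, hw, hv⟩ := bss_reduce k m v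
  have hAx : ∀ x, x ⬝ᵥ A.mulVec x = ∑ i, (v i ⬝ᵥ x) ^ 2 := by
    intro x
    have := bss_quad v (fun _ => 1) x
    simpa [hA] using this
  rcases isEmpty_or_nonempty {j // p j} with hE | hN
  · refine ⟨fun _ => 0, fun _ => le_rfl, by simp, ?_⟩
    intro x
    have : ∀ i, v i ⬝ᵥ x = 0 := fun i => by rw [hv]; simp [dotProduct]
    rw [hAx, bss_quad]
    simp [this]
  · have hcard : Fintype.card {j // p j} ≤ k := by
      simpa using Fintype.card_subtype_le p
    have hcard' : (Fintype.card {j // p j} : ℝ) ≤ k := by exact_mod_cast hcard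
    obtain ⟨s, hs0, hsc, hs⟩ := bss_identity w hw ε hε0 hε1 ⌈(k : ℝ) / ε ^ 2⌉₊
      ((div_le_div_of_nonneg_right hcard' (by positivity)).trans (Nat.le_ceil _))
    refine ⟨s, hs0, hsc, ?_⟩
    intro x
    have hyy : ∑ i, (w i ⬝ᵥ y x) ^ 2 = y x ⬝ᵥ y x := by
      have := bss_quad w (fun _ => 1) (y x)
      simp only [one_smul, one_mul, hw, Matrix.one_mulVec] at this
      exact this.symm
    rw [hAx, bss_quad]
    simp only [hv]
    rw [hyy]
    exact hs (y x)
end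

section
/- There is a universal constant C > 0 with the following property. Let 0 < ε < 1, let X be a k-dimensional linear subspace of ℝ^m equipped with the Euclidean norm ∥·∥₂. Then there exist a set σ ⊆ {1, 2, …, m} of cardinality n ≤ C ε⁻² k and positive real weights {s_i}_{i∈σ} such that ∥x∥₂ ≤ (Σ_{i∈σ} s_i x(i)²)^{1/2} ≤ (1+ε) ∥x∥₂ for all x = (x(1), …, x(m)) ∈ X. -/
section
open Matrix

theorem bss_factor {n : Type*} [Fintype n] [DecidableEq n] {A : Matrix n n ℝ} (hA : A.PosSemidef) :
    ∃ C : Matrix n n ℝ, A = Cᵀ * C := by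
  open scoped MatrixOrder in
  obtain ⟨C, hC⟩ := CStarAlgebra.nonneg_iff_eq_star_mul_self.mp hA.nonneg
  exact ⟨C, by rw [hC, Matrix.star_eq_conjTranspose, conjTranspose_eq_transpose_of_trivial]⟩

theorem bss_quad_le {n : Type*} [Fintype n] [DecidableEq n] {A : Matrix n n ℝ} (hA : A.PosSemidef)
    (x : n → ℝ) : x ⬝ᵥ (A *ᵥ x) ≤ A.trace * (x ⬝ᵥ x) := by
  obtain ⟨C, rfl⟩ := bss_factor hA
  have h1 : x ⬝ᵥ ((Cᵀ * C) *ᵥ x) = ∑ i, (∑ j, C i j * x j) ^ 2 := by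
    rw [← mulVec_mulVec, dotProduct_mulVec, vecMul_transpose]
    simp [dotProduct, mulVec, sq]
  have h2 : (Cᵀ * C).trace = ∑ i, ∑ j, C i j ^ 2 := by
    rw [trace_mul_comm]
    simp [trace, mul_apply, sq]
  rw [h1, h2, Finset.sum_mul]
  refine Finset.sum_le_sum fun i _ => ?_
  refine (Finset.sum_mul_sq_le_sq_mul_sq _ _ _).trans (le_of_eq ?_)
  simp [dotProduct, sq]

theorem bss_trace_quad {n : Type*} [Fintype n] [DecidableEq n] (C B : Matrix n n ℝ) :
    (Cᵀ * C * B).trace = ∑ i, C i ⬝ᵥ (B *ᵥ C i) := by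
  rw [Matrix.mul_assoc, trace_mul_comm]
  simp only [trace, diag, mul_mul_apply, transpose_transpose]

theorem bss_trace_mul_nonneg {n : Type*} [Fintype n] [DecidableEq n] {A B : Matrix n n ℝ}
    (hA : A.PosSemidef) (hB : B.PosSemidef) : 0 ≤ (A * B).trace := by
  obtain ⟨C, rfl⟩ := bss_factor hA
  rw [bss_trace_quad]
  exact Finset.sum_nonneg fun i _ => by simpa using hB.dotProduct_mulVec_nonneg (C i)

theorem bss_trace_mul_le {n : Type*} [Fintype n] [DecidableEq n] {A B : Matrix n n ℝ}
    (hA : A.PosSemidef) (hB : B.PosSemidef) : (A * B).trace ≤ A.trace * B.trace := by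
  obtain ⟨C, rfl⟩ := bss_factor hA
  have h2 : (Cᵀ * C).trace = ∑ i, C i ⬝ᵥ C i := by
    have := bss_trace_quad C 1
    simpa using this
  rw [bss_trace_quad, h2, Finset.sum_mul]
  exact Finset.sum_le_sum fun i _ => by rw [mul_comm]; exact bss_quad_le hB (C i)

theorem bss_dot_symm {n : Type*} [Fintype n] {A : Matrix n n ℝ} (hA : A.IsHermitian)
    (x y : n → ℝ) : x ⬝ᵥ (A *ᵥ y) = (A *ᵥ x) ⬝ᵥ y := by
  rw [dotProduct_mulVec, ← mulVec_transpose]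
  congr 2

/-- Completed square. -/
theorem bss_square {n : Type*} [Fintype n] [DecidableEq n] {P : Matrix n n ℝ} (hP : P.PosDef)
    (v x : n → ℝ) (c : ℝ) :
    0 ≤ x ⬝ᵥ (P *ᵥ x) - 2 * c * (v ⬝ᵥ x) + c ^ 2 * (v ⬝ᵥ (P⁻¹ *ᵥ v)) := by
  have h := hP.posSemidef.dotProduct_mulVec_nonneg (x - c • (P⁻¹ *ᵥ v))
  have hd : IsUnit P.det := (isUnit_iff_isUnit_det _).mp hP.isUnit
  have e : P *ᵥ (P⁻¹ *ᵥ v) = v := by rw [mulVec_mulVec, mul_nonsing_inv _ hd, one_mulVec]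
  have e2 : (P⁻¹ *ᵥ v) ⬝ᵥ (P *ᵥ x) = v ⬝ᵥ x := by rw [bss_dot_symm hP.1, e]
  simp only [star_trivial, mulVec_sub, mulVec_smul, e, sub_dotProduct, dotProduct_sub,
    smul_dotProduct, dotProduct_smul, smul_eq_mul, e2] at h
  rw [dotProduct_comm x v, dotProduct_comm _ v] at h
  linarith

theorem bss_vv_quad {n : Type*} [Fintype n] (v x : n → ℝ) :
    x ⬝ᵥ (vecMulVec v v *ᵥ x) = (v ⬝ᵥ x) ^ 2 := by
  rw [vecMulVec_mulVec]
  simp [dotProduct_comm x v, sq]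

theorem bss_vv_herm {n : Type*} (v : n → ℝ) : (vecMulVec v v).IsHermitian := by
  ext i j
  simp [vecMulVec_apply, mul_comm]

theorem bss_smul_herm {n : Type*} {A : Matrix n n ℝ} (h : A.IsHermitian) (t : ℝ) :
    (t • A).IsHermitian := by
  unfold IsHermitian at *
  rw [conjTranspose_smul, h]; simp

theorem bss_posdef_update {n : Type*} [Fintype n] [DecidableEq n] {P : Matrix n n ℝ}
    (hP : P.PosDef) (v : n → ℝ) (t : ℝ) (ht : 0 < 1 + t * (v ⬝ᵥ (P⁻¹ *ᵥ v))) :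
    (P + t • vecMulVec v v).PosDef := by
  refine PosDef.of_dotProduct_mulVec_pos (hP.1.add (bss_smul_herm (bss_vv_herm v) t)) ?_
  intro x hx
  have h1 := hP.dotProduct_mulVec_pos hx
  have h2 := bss_square hP v x (-t * (v ⬝ᵥ x))
  rw [star_trivial] at *
  rw [add_mulVec, dotProduct_add, smul_mulVec, dotProduct_smul, bss_vv_quad, smul_eq_mul]
  rcases le_or_gt 0 t with h | h
  · positivity
  · rcases eq_or_ne (v ⬝ᵥ x) 0 with h0 | h0
    · rw [h0]; simpa using h1
    · have : 0 < (-t) * (v ⬝ᵥ x) ^ 2 * (1 + t * (v ⬝ᵥ (P⁻¹ *ᵥ v))) :=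
        mul_pos (mul_pos (by linarith) (by positivity)) ht
      nlinarith

theorem bss_trace_mul_vv {n : Type*} [Fintype n] (M : Matrix n n ℝ) (v : n → ℝ) :
    (M * vecMulVec v v).trace = v ⬝ᵥ (M *ᵥ v) := by
  rw [mul_vecMulVec, trace_vecMulVec, dotProduct_comm]

theorem bss_trace_update {n : Type*} [Fintype n] [DecidableEq n] {P : Matrix n n ℝ}
    (hP : P.PosDef) (v : n → ℝ) (t : ℝ) (ht : 0 < 1 + t * (v ⬝ᵥ (P⁻¹ *ᵥ v))) :
    ((P + t • vecMulVec v v)⁻¹).trace = P⁻¹.trace -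
      t * (v ⬝ᵥ ((P⁻¹ * P⁻¹) *ᵥ v)) / (1 + t * (v ⬝ᵥ (P⁻¹ *ᵥ v))) := by
  have hd : IsUnit P.det := (isUnit_iff_isUnit_det _).mp hP.isUnit
  set w := v ⬝ᵥ (P⁻¹ *ᵥ v) with hw
  have hinv : (P + t • vecMulVec v v)⁻¹ =
      P⁻¹ - (t / (1 + t * w)) • (P⁻¹ * vecMulVec v v * P⁻¹) := by
    apply inv_eq_right_inv
    have e1 : vecMulVec v v * (P⁻¹ * vecMulVec v v * P⁻¹) = w • (vecMulVec v v * P⁻¹) := by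
      rw [← Matrix.mul_assoc, mul_vecMulVec P⁻¹, vecMulVec_mul_vecMulVec, vecMulVec_smul,
        Matrix.smul_mul]
    have e2 : P * (P⁻¹ * vecMulVec v v * P⁻¹) = vecMulVec v v * P⁻¹ := by
      rw [Matrix.mul_assoc, ← Matrix.mul_assoc P, mul_nonsing_inv _ hd, Matrix.one_mul]
    rw [Matrix.add_mul, Matrix.mul_sub, Matrix.mul_sub, Matrix.mul_smul, Matrix.smul_mul,
      Matrix.smul_mul, Matrix.mul_smul, e1, e2, mul_nonsing_inv _ hd]
    have : (t - t / (1 + t * w) - t * (t / (1 + t * w)) * w) = 0 := by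
      field_simp; ring
    have h3 : (t - t / (1 + t * w) - t * (t / (1 + t * w)) * w) • (vecMulVec v v * P⁻¹) = 0 := by
      rw [this, zero_smul]
    rw [sub_smul, sub_smul, mul_smul, mul_smul] at h3
    rw [← sub_eq_zero]
    rw [← h3]
    abel
  rw [hinv, trace_sub, trace_smul, trace_mul_cycle, bss_trace_mul_vv, smul_eq_mul]
  ring

/-- Shift estimates. -/
theorem bss_shift {n : Type*} [Fintype n] [DecidableEq n] {P : Matrix n n ℝ}
    (hP : P.PosDef) (δ : ℝ) (hδ : 0 < δ) (hP' : (P + δ • (1 : Matrix n n ℝ)).PosDef) :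
    P⁻¹.trace - ((P + δ • (1 : Matrix n n ℝ))⁻¹).trace =
      δ * ((P + δ • (1 : Matrix n n ℝ))⁻¹ * P⁻¹).trace ∧
    ((P + δ • (1 : Matrix n n ℝ))⁻¹ * (P + δ • (1 : Matrix n n ℝ))⁻¹).trace ≤
      ((P + δ • (1 : Matrix n n ℝ))⁻¹ * P⁻¹).trace ∧
    ((P + δ • (1 : Matrix n n ℝ))⁻¹ * P⁻¹).trace ≤ (P⁻¹ * P⁻¹).trace := by
  have hd : IsUnit P.det := (isUnit_iff_isUnit_det _).mp hP.isUnit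
  have hd' : IsUnit (P + δ • (1 : Matrix n n ℝ)).det := (isUnit_iff_isUnit_det _).mp hP'.isUnit
  set P' := P + δ • (1 : Matrix n n ℝ) with hdef
  have e : P⁻¹ - P'⁻¹ = δ • (P'⁻¹ * P⁻¹) := by
    have : P'⁻¹ * (P' - P) * P⁻¹ = P⁻¹ - P'⁻¹ := by
      rw [Matrix.mul_sub, Matrix.sub_mul, nonsing_inv_mul _ hd', Matrix.mul_assoc _ P,
        mul_nonsing_inv _ hd, Matrix.one_mul, Matrix.mul_one]
    rw [← this, hdef]
    simp
  have i1 := hP.inv.posSemidef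
  have i2 := hP'.inv.posSemidef
  have s2 : (P'⁻¹ * P'⁻¹).PosSemidef := by
    have := posSemidef_conjTranspose_mul_self (P'⁻¹)
    rwa [i2.1.eq] at this
  have s1 : (P⁻¹ * P⁻¹).PosSemidef := by
    have := posSemidef_conjTranspose_mul_self (P⁻¹)
    rwa [i1.1.eq] at this
  refine ⟨?_, ?_, ?_⟩
  · rw [← trace_sub, e, trace_smul, smul_eq_mul]
  · have : (P'⁻¹ * (P⁻¹ - P'⁻¹)).trace = δ * (P'⁻¹ * P'⁻¹ * P⁻¹).trace := by
      rw [e, Matrix.mul_smul, trace_smul, Matrix.mul_assoc, smul_eq_mul]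
    rw [Matrix.mul_sub, trace_sub] at this
    have := mul_nonneg hδ.le (bss_trace_mul_nonneg s2 i1)
    linarith
  · have : ((P⁻¹ - P'⁻¹) * P⁻¹).trace = δ * (P'⁻¹ * (P⁻¹ * P⁻¹)).trace := by
      rw [e, Matrix.smul_mul, trace_smul, Matrix.mul_assoc, smul_eq_mul]
    rw [Matrix.sub_mul, trace_sub] at this
    have := mul_nonneg hδ.le (bss_trace_mul_nonneg i2 s1)
    linarith

theorem bss_trace_prod_pos {n : Type*} [Fintype n] [DecidableEq n] [Nonempty n] {A : Matrix n n ℝ}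
    (hA : A.PosDef) : 0 < (A * A).trace := by
  have h : (A * A).PosSemidef := by
    have := posSemidef_conjTranspose_mul_self A
    rwa [hA.1.eq] at this
  refine lt_of_le_of_ne h.trace_nonneg fun h0 => ?_
  have := trace_conjTranspose_mul_self_eq_zero_iff (A := A)
  rw [hA.1.eq] at this
  have h1 := this.mp h0.symm
  have := hA.trace_pos
  simp [h1] at this

/-- Lower barrier may be shifted by one. -/
theorem bss_lower_shift {n : Type*} [Fintype n] [DecidableEq n] {Q : Matrix n n ℝ}
    (hQ : Q.PosDef) (hη : Q⁻¹.trace < 1) : (Q - (1 : Matrix n n ℝ)).PosDef := by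
  refine PosDef.of_dotProduct_mulVec_pos (hQ.1.sub isHermitian_one) ?_
  intro x hx
  have h1 := hQ.dotProduct_mulVec_pos hx
  have h2 := bss_square hQ x x 1
  have h3 := bss_quad_le hQ.inv.posSemidef x
  have h4 : 0 < x ⬝ᵥ x := by
    have := (PosDef.one (n := n) (R := ℝ)).dotProduct_mulVec_pos hx
    simpa using this
  rw [star_trivial] at *
  rw [sub_mulVec, dotProduct_sub, one_mulVec]
  nlinarith

theorem bss_sum_quad {ι n : Type*} [Fintype ι] [Fintype n] [DecidableEq n] (v : ι → n → ℝ)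
    (hv : ∑ i, vecMulVec (v i) (v i) = (1 : Matrix n n ℝ)) (M : Matrix n n ℝ) :
    ∑ i, v i ⬝ᵥ (M *ᵥ v i) = M.trace := by
  simp_rw [← bss_trace_mul_vv]
  rw [← trace_sum, ← Matrix.mul_sum, hv, Matrix.mul_one]

theorem bss_step_s1 {ι n : Type*} [Fintype ι] [Fintype n] [DecidableEq n] [Nonempty n]
    (v : ι → n → ℝ) (hv : ∑ i, vecMulVec (v i) (v i) = (1 : Matrix n n ℝ))
    (η δ : ℝ) (hη : 0 < η) (hη' : η < 1 / 3) (hδ : δ * (1 - 3 * η) = 1)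
    {P Q : Matrix n n ℝ} (hP : P.PosDef) (hPt : P⁻¹.trace ≤ η)
    (hQ : Q.PosDef) (hQt : Q⁻¹.trace ≤ η) :
    ∃ (i : ι) (t : ℝ), 0 < t ∧
      (P + δ • (1 : Matrix n n ℝ) + (-t) • vecMulVec (v i) (v i)).PosDef ∧
      ((P + δ • (1 : Matrix n n ℝ) + (-t) • vecMulVec (v i) (v i))⁻¹).trace ≤ η ∧
      (Q - (1 : Matrix n n ℝ) + t • vecMulVec (v i) (v i)).PosDef ∧
      ((Q - (1 : Matrix n n ℝ) + t • vecMulVec (v i) (v i))⁻¹).trace ≤ η := by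
  have hδ0 : 0 < δ := by
    by_contra h
    nlinarith
  have hP' : (P + δ • (1 : Matrix n n ℝ)).PosDef := hP.add (PosDef.one.smul hδ0)
  have hQ' : (Q - (1 : Matrix n n ℝ)).PosDef := bss_lower_shift hQ (by linarith)
  obtain ⟨u1, u2, -⟩ := bss_shift hP δ hδ0 hP'
  have eQ : Q - (1 : Matrix n n ℝ) + (1 : ℝ) • (1 : Matrix n n ℝ) = Q := by simp
  obtain ⟨l1, l2, l3⟩ := bss_shift hQ' 1 one_pos (by rw [eQ]; exact hQ)
  rw [eQ] at l1 l2 l3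
  have l4 := bss_trace_mul_le hQ.inv.posSemidef hQ'.inv.posSemidef
  have u5 := bss_trace_prod_pos hP'.inv
  have l5 := bss_trace_prod_pos hQ.inv
  have l6 := hQ'.inv.trace_pos
  have u6 := hP'.inv.trace_pos
  set M := (P + δ • (1 : Matrix n n ℝ))⁻¹ with hM
  set N := (Q - (1 : Matrix n n ℝ))⁻¹ with hN
  set DU := P⁻¹.trace - M.trace with hDU
  set DL := N.trace - Q⁻¹.trace with hDL
  have hDU0 : 0 < DU := by rw [u1]; exact mul_pos hδ0 (by linarith)
  have hDL0 : 0 < DL := by rw [l1]; linarith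
  have sU : ∑ i, (v i ⬝ᵥ ((M * M) *ᵥ v i) / DU + v i ⬝ᵥ (M *ᵥ v i)) ≤ 1 - 2 * η := by
    rw [Finset.sum_add_distrib, ← Finset.sum_div, bss_sum_quad v hv, bss_sum_quad v hv]
    have : (M * M).trace / DU ≤ 1 - 3 * η := by
      rw [div_le_iff₀ hDU0, u1]
      calc (M * M).trace ≤ (M * P⁻¹).trace := u2
        _ = (δ * (1 - 3 * η)) * (M * P⁻¹).trace := by rw [hδ, one_mul]
        _ = _ := by ring
    linarith
  have sL : 1 - 2 * η < ∑ i, (v i ⬝ᵥ ((N * N) *ᵥ v i) / DL - v i ⬝ᵥ (N *ᵥ v i)) := by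
    rw [Finset.sum_sub_distrib, ← Finset.sum_div, bss_sum_quad v hv, bss_sum_quad v hv]
    have : 1 ≤ (N * N).trace / DL := by
      rw [le_div_iff₀ hDL0, l1]
      linarith
    have : N.trace < 2 * η := by
      by_contra hc
      nlinarith
    linarith
  obtain ⟨i, -, hi⟩ := Finset.exists_lt_of_sum_lt (lt_of_le_of_lt sU sL)
  have a0 : 0 ≤ v i ⬝ᵥ (M *ᵥ v i) := by
    simpa using hP'.inv.posSemidef.dotProduct_mulVec_nonneg (v i)
  have c0 : 0 ≤ v i ⬝ᵥ (N *ᵥ v i) := by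
    simpa using hQ'.inv.posSemidef.dotProduct_mulVec_nonneg (v i)
  have b0 : 0 ≤ v i ⬝ᵥ ((M * M) *ᵥ v i) := by
    rw [← mulVec_mulVec, bss_dot_symm hP'.inv.1]
    exact Finset.sum_nonneg fun j _ => mul_self_nonneg _
  set a := v i ⬝ᵥ (M *ᵥ v i) with ha
  set b := v i ⬝ᵥ ((M * M) *ᵥ v i) with hb
  set c := v i ⬝ᵥ (N *ᵥ v i) with hc
  set d := v i ⬝ᵥ ((N * N) *ᵥ v i) with hd
  set L := d / DL - c with hL
  have hbD : 0 ≤ b / DU := div_nonneg b0 hDU0.le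
  have hL0 : 0 < L := by linarith
  have htL : L⁻¹ * L = 1 := inv_mul_cancel₀ hL0.ne'
  have ht0 : 0 < L⁻¹ := inv_pos.mpr hL0
  have k1 : 0 < 1 + (-L⁻¹) * a := by nlinarith
  have k2 : 0 < 1 + L⁻¹ * c := by positivity
  refine ⟨i, L⁻¹, ht0, bss_posdef_update hP' _ _ k1, ?_, bss_posdef_update hQ' _ _ k2, ?_⟩
  · rw [bss_trace_update hP' _ _ k1, ← hM, ← ha, ← hb]
    have : L⁻¹ * b / (1 + (-L⁻¹) * a) ≤ DU := by
      rw [div_le_iff₀ k1]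
      have h1 : b / DU ≤ L - a := by linarith
      rw [div_le_iff₀ hDU0] at h1
      have := mul_le_mul_of_nonneg_left h1 ht0.le
      calc L⁻¹ * b ≤ _ := this
        _ = DU * (L⁻¹ * L + (-L⁻¹) * a) := by ring
        _ = _ := by rw [htL]
    have e : (-L⁻¹) * b / (1 + (-L⁻¹) * a) = - (L⁻¹ * b / (1 + (-L⁻¹) * a)) := by ring
    rw [e]
    linarith
  · rw [bss_trace_update hQ' _ _ k2, ← hN, ← hc, ← hd]
    have : DL ≤ L⁻¹ * d / (1 + L⁻¹ * c) := by
      rw [le_div_iff₀ k2]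
      have h1 : d = (L + c) * DL := by rw [hL]; field_simp; ring
      have : L⁻¹ * d = DL * (L⁻¹ * L + L⁻¹ * c) := by rw [h1]; ring
      rw [this, htL]
    linarith

theorem bss_iter {ι n : Type*} [Fintype ι] [DecidableEq ι] [Fintype n] [DecidableEq n] [Nonempty n]
    (v : ι → n → ℝ) (hv : ∑ i, vecMulVec (v i) (v i) = (1 : Matrix n n ℝ))
    (η δ : ℝ) (hη : 0 < η) (hη' : η < 1 / 3) (hδ : δ * (1 - 3 * η) = 1) (N : ℕ) :
    ∃ (σ : Finset ι) (s : ι → ℝ), σ.card ≤ N ∧ (∀ i ∈ σ, 0 < s i) ∧ (∀ i, i ∉ σ → s i = 0) ∧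
      ((Fintype.card n / η + N * δ) • (1 : Matrix n n ℝ)
        - ∑ i, s i • vecMulVec (v i) (v i)).PosDef ∧
      (((Fintype.card n / η + N * δ) • (1 : Matrix n n ℝ)
        - ∑ i, s i • vecMulVec (v i) (v i))⁻¹).trace ≤ η ∧
      (∑ i, s i • vecMulVec (v i) (v i)
        - (N - Fintype.card n / η) • (1 : Matrix n n ℝ)).PosDef ∧
      ((∑ i, s i • vecMulVec (v i) (v i)
        - (N - Fintype.card n / η) • (1 : Matrix n n ℝ))⁻¹).trace ≤ η := by
  induction N with
  | zero =>
    have hk : (0 : ℝ) < Fintype.card n := by exact_mod_cast Fintype.card_pos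
    have hpos : 0 < Fintype.card n / η := by positivity
    have hpd : ((Fintype.card n / η) • (1 : Matrix n n ℝ)).PosDef := PosDef.one.smul hpos
    have htr : (((Fintype.card n / η) • (1 : Matrix n n ℝ))⁻¹).trace ≤ η := by
      have : ((Fintype.card n / η) • (1 : Matrix n n ℝ))⁻¹
          = (η / Fintype.card n) • (1 : Matrix n n ℝ) := by
        apply inv_eq_right_inv
        rw [Matrix.smul_mul, Matrix.one_mul, smul_smul]
        have : (Fintype.card n / η) * (η / Fintype.card n) = 1 := by field_simp
        rw [this, one_smul]
      rw [this, trace_smul, trace_one, smul_eq_mul]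
      field_simp
      exact le_refl _
    refine ⟨∅, 0, by simp, by simp, by simp, ?_, ?_, ?_, ?_⟩ <;> simpa using by assumption
  | succ N ih =>
    obtain ⟨σ, s, h1, h2, h3, h4, h5, h6, h7⟩ := ih
    obtain ⟨i, t, ht, g1, g2, g3, g4⟩ := bss_step_s1 v hv η δ hη hη' hδ h4 h5 h6 h7
    have hs0 : ∀ j, 0 ≤ s j := fun j => by
      by_cases hj : j ∈ σ
      · exact (h2 j hj).le
      · exact (h3 j hj).ge
    have hsum : ∑ j, (s j + if j = i then t else 0) • vecMulVec (v j) (v j) =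
        ∑ j, s j • vecMulVec (v j) (v j) + t • vecMulVec (v i) (v i) := by
      simp [add_smul, Finset.sum_add_distrib, ite_smul]
    have eu : (Fintype.card n / η + (N + 1 : ℕ) * δ) • (1 : Matrix n n ℝ)
        - ∑ j, (s j + if j = i then t else 0) • vecMulVec (v j) (v j) =
        (Fintype.card n / η + N * δ) • (1 : Matrix n n ℝ)
        - ∑ i, s i • vecMulVec (v i) (v i) + δ • (1 : Matrix n n ℝ)
          + (-t) • vecMulVec (v i) (v i) := by
      rw [hsum]
      push_cast
      module
    have el : ∑ j, (s j + if j = i then t else 0) • vecMulVec (v j) (v j)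
        - ((N + 1 : ℕ) - Fintype.card n / η) • (1 : Matrix n n ℝ) =
        ∑ i, s i • vecMulVec (v i) (v i)
        - (N - Fintype.card n / η) • (1 : Matrix n n ℝ) - 1 + t • vecMulVec (v i) (v i) := by
      rw [hsum]
      push_cast
      module
    refine ⟨insert i σ, fun j => s j + if j = i then t else 0, ?_, ?_, ?_, ?_, ?_, ?_, ?_⟩
    · exact (Finset.card_insert_le _ _).trans (by omega)
    · intro j hj
      by_cases hji : j = i
      · have := hs0 j
        simp only [hji, if_true] at this ⊢
        linarith
      · simp only [hji, if_false, add_zero]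
        exact h2 j ((Finset.mem_insert.mp hj).resolve_left hji)
    · intro j hj
      rw [Finset.mem_insert, not_or] at hj
      simp [hj.1, h3 j hj.2]
    · rw [eu]; exact g1
    · rw [eu]; exact g2
    · rw [el]; exact g3
    · rw [el]; exact g4

theorem bss_quad_sum {ι n : Type*} [Fintype ι] [Fintype n] (v : ι → n → ℝ) (s : ι → ℝ)
    (x : n → ℝ) :
    x ⬝ᵥ ((∑ i, s i • vecMulVec (v i) (v i)) *ᵥ x) = ∑ i, s i * (v i ⬝ᵥ x) ^ 2 := by
  rw [Matrix.sum_mulVec, dotProduct_sum]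
  simp_rw [smul_mulVec, dotProduct_smul, bss_vv_quad, smul_eq_mul]

theorem bss_main {ι n : Type*} [Fintype ι] [DecidableEq ι] [Fintype n] [DecidableEq n] [Nonempty n]
    (v : ι → n → ℝ) (hv : ∑ i, vecMulVec (v i) (v i) = (1 : Matrix n n ℝ))
    (ε : ℝ) (hε : 0 < ε) (hε' : ε < 1) :
    ∃ (σ : Finset ι) (s : ι → ℝ), (σ.card : ℝ) ≤ 65 * ε⁻¹ ^ 2 * Fintype.card n ∧
      (∀ i ∈ σ, 0 < s i) ∧ ∀ x : n → ℝ,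
        x ⬝ᵥ x ≤ ∑ i ∈ σ, s i * (v i ⬝ᵥ x) ^ 2 ∧
        ∑ i ∈ σ, s i * (v i ⬝ᵥ x) ^ 2 ≤ (1 + ε) ^ 2 * (x ⬝ᵥ x) := by
  have hk : (1 : ℝ) ≤ Fintype.card n := by exact_mod_cast Fintype.card_pos
  set k : ℝ := ((Fintype.card n : ℕ) : ℝ) with hkdef
  obtain ⟨η, rfl⟩ : ∃ η, ε = 8 * η := ⟨ε / 8, by ring⟩
  have hη : 0 < η := by linarith
  have hη8 : η < 1 / 8 := by linarith
  have h3 : 0 < 1 - 3 * η := by linarith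
  set N := ⌈k / η ^ 2⌉₊ with hN
  have N1 : k / η ^ 2 ≤ N := Nat.le_ceil _
  have N2 : (N : ℝ) < k / η ^ 2 + 1 := Nat.ceil_lt_add_one (by positivity)
  obtain ⟨σ, s, h1, h2, h2', h4, -, h6, -⟩ := bss_iter v hv η (1 - 3 * η)⁻¹ hη (by linarith)
    (inv_mul_cancel₀ h3.ne') N
  have hsum : ∀ x : n → ℝ, ∑ i, s i * (v i ⬝ᵥ x) ^ 2 = ∑ i ∈ σ, s i * (v i ⬝ᵥ x) ^ 2 := fun x => by
    symm
    apply Finset.sum_subset (Finset.subset_univ _)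
    intro i _ hi
    rw [h2' i hi, zero_mul]
  have hkN : k / η ≤ η * N := by
    calc k / η = η * (k / η ^ 2) := by field_simp
      _ ≤ _ := by gcongr
  have hN0 : (0 : ℝ) < N := lt_of_lt_of_le (by positivity) N1
  have hl : 0 < N - k / η := by nlinarith
  have hδ : (1 - 3 * η)⁻¹ ≤ 1 + 5 * η := by
    rw [inv_le_iff_one_le_mul₀ h3]
    nlinarith
  have hu : k / η + N * (1 - 3 * η)⁻¹ ≤ (1 + 8 * η) ^ 2 * (N - k / η) := by
    have e1 : k / η + N * (1 - 3 * η)⁻¹ ≤ N * (1 + 6 * η) := by nlinarith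
    have e2 : (1 + 8 * η) ^ 2 * (N * (1 - η)) ≤ (1 + 8 * η) ^ 2 * (N - k / η) := by
      gcongr; linarith
    have e3 : 1 + 6 * η ≤ (1 + 8 * η) ^ 2 * (1 - η) := by nlinarith [sq_nonneg η, mul_pos hη hη]
    nlinarith
  refine ⟨σ, fun i => (N - k / η)⁻¹ * s i, ?_, fun i hi => mul_pos (inv_pos.mpr hl) (h2 i hi), ?_⟩
  · have : (σ.card : ℝ) ≤ N := by exact_mod_cast h1
    have e : 65 * (8 * η)⁻¹ ^ 2 * k = k / η ^ 2 + k / (64 * η ^ 2) := by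
      field_simp; ring
    have : 1 ≤ k / (64 * η ^ 2) := by
      rw [le_div_iff₀ (by positivity)]
      nlinarith
    rw [e]; linarith
  · intro x
    have q1 := h4.posSemidef.dotProduct_mulVec_nonneg x
    have q2 := h6.posSemidef.dotProduct_mulVec_nonneg x
    rw [star_trivial, sub_mulVec, dotProduct_sub, bss_quad_sum, smul_mulVec, one_mulVec,
      dotProduct_smul, smul_eq_mul, hsum] at q1 q2
    have hx : 0 ≤ x ⬝ᵥ x := Finset.sum_nonneg fun j _ => mul_self_nonneg _
    simp_rw [mul_assoc]
    rw [← Finset.mul_sum]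
    constructor
    · rw [le_inv_mul_iff₀ hl]
      linarith
    · rw [inv_mul_le_iff₀ hl]
      have := mul_le_mul_of_nonneg_right hu hx
      linarith

end

/-- There is a universal constant `C > 0` such that for every `0 < ε < 1` and every
`k`-dimensional subspace `X` of Euclidean space `ℝ^m`, there exist a set
`σ ⊆ {1, …, m}` of cardinality `n ≤ C ε⁻² k` and positive weights `{s i}_{i ∈ σ}`
such that `‖x‖₂ ≤ (∑ i ∈ σ, s i * x i ^ 2) ^ (1/2) ≤ (1 + ε) ‖x‖₂` for all `x ∈ X`. -/
theorem subspace_sampling_euclidean :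
    ∃ C : ℝ, 0 < C ∧
      ∀ (m k : ℕ) (ε : ℝ), 0 < ε → ε < 1 →
        ∀ X : Submodule ℝ (EuclideanSpace ℝ (Fin m)),
          Module.finrank ℝ X = k →
          ∃ (σ : Finset (Fin m)) (s : Fin m → ℝ),
            (σ.card : ℝ) ≤ C * ε⁻¹ ^ 2 * k ∧
            (∀ i ∈ σ, 0 < s i) ∧
            ∀ x ∈ X,
              ‖x‖ ≤ Real.sqrt (∑ i ∈ σ, s i * x i ^ 2) ∧
              Real.sqrt (∑ i ∈ σ, s i * x i ^ 2) ≤ (1 + ε) * ‖x‖ := by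
  refine ⟨65, by norm_num, ?_⟩
  intro m k ε hε hε' X hX
  rcases Nat.eq_zero_or_pos k with rfl | hk
  · refine ⟨∅, 0, by simp, by simp, ?_⟩
    intro x hx
    have : X = ⊥ := Submodule.finrank_eq_zero.mp hX
    rw [this, Submodule.mem_bot] at hx
    simp [hx]
  subst hX
  have : Nonempty (Fin (Module.finrank ℝ X)) := ⟨⟨0, hk⟩⟩
  let b := stdOrthonormalBasis ℝ X
  let v : Fin m → Fin (Module.finrank ℝ X) → ℝ := fun i j => (b j : EuclideanSpace ℝ (Fin m)) i
  have hv : ∑ i, Matrix.vecMulVec (v i) (v i) = 1 := by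
    ext j l
    have h := b.inner_eq_ite j l
    rw [Submodule.coe_inner, PiLp.inner_apply] at h
    rw [Matrix.sum_apply, Matrix.one_apply, ← h]
    refine Finset.sum_congr rfl fun i _ => ?_
    simp [Matrix.vecMulVec_apply, v, mul_comm]
  obtain ⟨σ, s, h1, h2, h3⟩ := bss_main v hv ε hε hε'
  refine ⟨σ, s, by simpa using h1, h2, ?_⟩
  intro x hx
  let c : Fin (Module.finrank ℝ X) → ℝ := fun j => b.repr ⟨x, hx⟩ j
  have hxc : ∀ i, dotProduct (v i) c = x i := by
    intro i
    have h := congrArg (fun y : X => (y : EuclideanSpace ℝ (Fin m)) i) (b.sum_repr ⟨x, hx⟩)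
    simp only [Submodule.coe_sum, Submodule.coe_smul] at h
    rw [← h]
    simp [dotProduct, v, c, mul_comm]
  have hn : dotProduct c c = ‖x‖ ^ 2 := by
    have h : ‖b.repr ⟨x, hx⟩‖ = ‖x‖ := by rw [LinearIsometryEquiv.norm_map]; rfl
    rw [← h, EuclideanSpace.norm_sq_eq]
    simp [dotProduct, c, sq]
  have h := h3 c
  simp_rw [hxc, hn] at h
  constructor
  · exact Real.le_sqrt_of_sq_le h.1
  · rw [Real.sqrt_le_left (by positivity), mul_pow]
    exact h.2
end

section
/- There is a universal constant C > 0 with the following property. Let p be a positive even integer, let k be a positive integer with p ≤ k, let 0 < ε < 1, and let X be a k-dimensional linear subspace of a space L_p(μ) over a measure space (Ω, μ). Then there exist a positive integer n ≤ C ε⁻² (10k/p)^{p/2} and a linear map T : X → ℓ_p^n such that ∥x∥_{L_p} ≤ ∥Tx∥_p ≤ (1+ε) ∥x∥_{L_p} for all x ∈ X. In other words, X (1+ε)-embeds in ℓ_p^n for n = O(ε⁻² (10k/p)^{p/2}). -/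
open MeasureTheory ENNReal

namespace BSS
open Matrix

variable {D : ℕ}

lemma inv_conj (U : Matrix (Fin D) (Fin D) ℝ) (h1 : U * Uᵀ = 1) (h2 : Uᵀ * U = 1)
    (d : Fin D → ℝ) (hd : ∀ i, d i ≠ 0) :
    (U * diagonal d * Uᵀ)⁻¹ = U * diagonal (fun i => (d i)⁻¹) * Uᵀ := by
  apply Matrix.inv_eq_right_inv
  calc U * diagonal d * Uᵀ * (U * diagonal (fun i => (d i)⁻¹) * Uᵀ)
      = U * diagonal d * (Uᵀ * U) * diagonal (fun i => (d i)⁻¹) * Uᵀ := by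
        simp only [Matrix.mul_assoc]
    _ = U * (diagonal d * diagonal (fun i => (d i)⁻¹)) * Uᵀ := by
        rw [h2]; simp only [Matrix.mul_assoc, Matrix.mul_one]
    _ = 1 := by
        rw [diagonal_mul_diagonal]
        simp [hd, h1]

lemma trace_conj (U : Matrix (Fin D) (Fin D) ℝ) (h2 : Uᵀ * U = 1)
    (d : Fin D → ℝ) : (U * diagonal d * Uᵀ).trace = ∑ i, d i := by
  rw [Matrix.trace_mul_comm, ← Matrix.mul_assoc, h2, Matrix.one_mul, Matrix.trace_diagonal]

lemma posDef_conj (U : Matrix (Fin D) (Fin D) ℝ) (h1 : U * Uᵀ = 1)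
    (d : Fin D → ℝ) (hd : ∀ i, 0 < d i) : (U * diagonal d * Uᵀ).PosDef := by
  have h := (Matrix.PosDef.diagonal hd)
  have := h.mul_mul_conjTranspose_same (B := U) (by
    intro x y hxy
    have : (x ᵥ* U) ᵥ* Uᵀ = (y ᵥ* U) ᵥ* Uᵀ := by 
      have h : x ᵥ* U = y ᵥ* U := hxy
      rw [h]
    simpa [Matrix.vecMul_vecMul, h1] using this)
  simpa using this

lemma exists_diag (M : Matrix (Fin D) (Fin D) ℝ) (hM : M.PosDef) :
    ∃ (U : Matrix (Fin D) (Fin D) ℝ) (d : Fin D → ℝ), U * Uᵀ = 1 ∧ Uᵀ * U = 1 ∧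
      (∀ i, 0 < d i) ∧ M = U * diagonal d * Uᵀ := by
  refine ⟨hM.1.eigenvectorUnitary, hM.1.eigenvalues, ?_, ?_, hM.eigenvalues_pos, ?_⟩
  · exact Unitary.mul_star_self_of_mem (hM.1.eigenvectorUnitary).2
  · exact Unitary.star_mul_self_of_mem (hM.1.eigenvectorUnitary).2
  · have := hM.1.spectral_theorem
    rw [Unitary.conjStarAlgAut_apply] at this
    exact this

lemma add_conj (U : Matrix (Fin D) (Fin D) ℝ) (h1 : U * Uᵀ = 1) (d : Fin D → ℝ) (c : ℝ) :
    U * diagonal d * Uᵀ + c • (1 : Matrix (Fin D) (Fin D) ℝ)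
      = U * diagonal (fun i => d i + c) * Uᵀ := by
  have : diagonal (fun i => d i + c) = diagonal d + c • (1 : Matrix (Fin D) (Fin D) ℝ) := by
    rw [← diagonal_one, ← diagonal_smul, diagonal_add]
    simp
  rw [this, Matrix.mul_add, Matrix.add_mul]
  simp [h1]

lemma sq_conj (U : Matrix (Fin D) (Fin D) ℝ) (h2 : Uᵀ * U = 1) (d : Fin D → ℝ) :
    (U * diagonal d * Uᵀ) * (U * diagonal d * Uᵀ) = U * diagonal (fun i => d i * d i) * Uᵀ := by
  calc (U * diagonal d * Uᵀ) * (U * diagonal d * Uᵀ)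
      = U * diagonal d * (Uᵀ * U) * diagonal d * Uᵀ := by
        simp only [Matrix.mul_assoc]
    _ = U * (diagonal d * diagonal d) * Uᵀ := by
        rw [h2]; simp only [Matrix.mul_assoc, Matrix.mul_one]
    _ = _ := by rw [diagonal_mul_diagonal]

lemma upper_spec [NeZero D] (M : Matrix (Fin D) (Fin D) ℝ) (hM : M.PosDef) (δ : ℝ) (hδ : 0 < δ) :
    (M + δ • (1 : Matrix (Fin D) (Fin D) ℝ)).PosDef ∧
    (M + δ • (1 : Matrix (Fin D) (Fin D) ℝ))⁻¹.trace < M⁻¹.trace ∧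
    δ * ((M + δ • (1 : Matrix (Fin D) (Fin D) ℝ))⁻¹ *
      (M + δ • (1 : Matrix (Fin D) (Fin D) ℝ))⁻¹).trace ≤
      M⁻¹.trace - (M + δ • (1 : Matrix (Fin D) (Fin D) ℝ))⁻¹.trace := by
  obtain ⟨U, d, h1, h2, hd, rfl⟩ := exists_diag M hM
  have hd' : ∀ i, 0 < d i + δ := fun i => add_pos (hd i) hδ
  rw [add_conj U h1, inv_conj U h1 h2 _ (fun i => (hd' i).ne'),
    inv_conj U h1 h2 _ (fun i => (hd i).ne'), sq_conj U h2, trace_conj U h2, trace_conj U h2,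
    trace_conj U h2]
  refine ⟨posDef_conj U h1 _ hd', ?_, ?_⟩
  · apply Finset.sum_lt_sum_of_nonempty
    · exact ⟨⟨0, Nat.pos_of_ne_zero (NeZero.ne D)⟩, Finset.mem_univ _⟩
    · intro i _
      have := hd i
      exact inv_strictAnti₀ this (by linarith)
  · rw [Finset.mul_sum, ← Finset.sum_sub_distrib]
    apply Finset.sum_le_sum
    intro i _
    have h := hd i
    have h' := hd' i
    have e : (d i)⁻¹ - (d i + δ)⁻¹ - δ * ((d i + δ)⁻¹ * (d i + δ)⁻¹)
      = δ ^ 2 * ((d i)⁻¹ * (d i + δ)⁻¹ * (d i + δ)⁻¹) := by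
      field_simp
      ring
    have : 0 ≤ δ ^ 2 * ((d i)⁻¹ * (d i + δ)⁻¹ * (d i + δ)⁻¹) := by positivity
    linarith

lemma lower_spec [NeZero D] (M : Matrix (Fin D) (Fin D) ℝ) (hM : M.PosDef)
    (ht : M⁻¹.trace < 1) :
    (M + (-1 : ℝ) • (1 : Matrix (Fin D) (Fin D) ℝ)).PosDef ∧
    M⁻¹.trace < (M + (-1 : ℝ) • (1 : Matrix (Fin D) (Fin D) ℝ))⁻¹.trace ∧
    ((M + (-1 : ℝ) • (1 : Matrix (Fin D) (Fin D) ℝ))⁻¹.trace - M⁻¹.trace) +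
    ((M + (-1 : ℝ) • (1 : Matrix (Fin D) (Fin D) ℝ))⁻¹.trace - M⁻¹.trace) ^ 2 ≤
    ((M + (-1 : ℝ) • (1 : Matrix (Fin D) (Fin D) ℝ))⁻¹ *
      (M + (-1 : ℝ) • (1 : Matrix (Fin D) (Fin D) ℝ))⁻¹).trace := by
  obtain ⟨U, d, h1, h2, hd, rfl⟩ := exists_diag M hM
  rw [inv_conj U h1 h2 _ (fun i => (hd i).ne'), trace_conj U h2] at ht
  have hd' : ∀ i, 0 < d i + -1 := by
    intro i
    have : (d i)⁻¹ ≤ ∑ i, (d i)⁻¹ :=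
      Finset.single_le_sum (f := fun i => (d i)⁻¹) (fun i _ => (inv_pos.2 (hd i)).le)
        (Finset.mem_univ i)
    have h3 : (d i)⁻¹ < 1 := by linarith
    have := (inv_lt_one₀ (hd i)).1 h3
    linarith
  rw [add_conj U h1, inv_conj U h1 h2 _ (fun i => (hd' i).ne'),
    inv_conj U h1 h2 _ (fun i => (hd i).ne'), sq_conj U h2, trace_conj U h2, trace_conj U h2,
    trace_conj U h2]
  refine ⟨posDef_conj U h1 _ hd', ?_, ?_⟩
  · apply Finset.sum_lt_sum_of_nonempty
    · exact ⟨⟨0, Nat.pos_of_ne_zero (NeZero.ne D)⟩, Finset.mem_univ _⟩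
    · intro i _
      have := hd' i
      exact inv_strictAnti₀ this (by linarith)
  · rw [← Finset.sum_sub_distrib]
    have cs : (∑ i, ((d i + -1)⁻¹ - (d i)⁻¹)) ^ 2 ≤
        (∑ i, (d i)⁻¹) * ∑ i, (d i)⁻¹ * ((d i + -1)⁻¹ * (d i + -1)⁻¹) := by
      apply Finset.sum_sq_le_sum_mul_sum_of_sq_le_mul
      · intro i _
        exact (inv_pos.2 (hd i)).le
      · intro i _
        have := hd i
        have := hd' i
        positivity
      · intro i _
        apply le_of_eq
        have := (hd i).ne'
        have := (hd' i).ne'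
        field_simp
        ring
    have nn : 0 ≤ ∑ i, (d i)⁻¹ * ((d i + -1)⁻¹ * (d i + -1)⁻¹) := by
      apply Finset.sum_nonneg
      intro i _
      have := hd i
      have := hd' i
      positivity
    have e : ∑ i, (d i + -1)⁻¹ * (d i + -1)⁻¹ = ∑ i, ((d i + -1)⁻¹ - (d i)⁻¹) +
        ∑ i, (d i)⁻¹ * ((d i + -1)⁻¹ * (d i + -1)⁻¹) := by
      rw [← Finset.sum_add_distrib]
      apply Finset.sum_congr rfl
      intro i _
      have := (hd i).ne'
      have := (hd' i).ne'
      field_simp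
      ring
    rw [e]
    nlinarith

lemma rank_one (M : Matrix (Fin D) (Fin D) ℝ) (hM : M.PosDef) (v : Fin D → ℝ) (c : ℝ)
    (hc : 0 < 1 + c * (v ⬝ᵥ M⁻¹ *ᵥ v)) :
    (M + c • vecMulVec v v).PosDef ∧
    (M + c • vecMulVec v v)⁻¹.trace =
      M⁻¹.trace - c * (v ⬝ᵥ (M⁻¹ * M⁻¹) *ᵥ v) / (1 + c * (v ⬝ᵥ M⁻¹ *ᵥ v)) := by
  have hsym : M⁻¹ᵀ = M⁻¹ := by
    have := hM.inv.1
    simpa [Matrix.IsHermitian] using this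
  have hMs : Mᵀ = M := by
    have := hM.1
    simpa [Matrix.IsHermitian] using this
  have hu : IsUnit M.det := (Matrix.isUnit_iff_isUnit_det _).1 hM.isUnit
  set w := M⁻¹ *ᵥ v with hw
  set q := v ⬝ᵥ w with hq
  have hMw : M *ᵥ w = v := by
    rw [hw, mulVec_mulVec, mul_nonsing_inv _ hu, one_mulVec]
  have hvM : v ᵥ* M⁻¹ = w := by
    rw [hw, ← Matrix.vecMul_transpose, hsym]
  constructor
  · refine Matrix.PosDef.of_dotProduct_mulVec_pos ?_ ?_
    · unfold Matrix.IsHermitian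
      simp [hMs, Matrix.transpose_vecMulVec]
    · intro x hx
      have hpos := hM.dotProduct_mulVec_pos hx
      simp only [star_trivial] at hpos ⊢
      have hexp : x ⬝ᵥ (M + c • vecMulVec v v) *ᵥ x = x ⬝ᵥ M *ᵥ x + c * (v ⬝ᵥ x) ^ 2 := by
        rw [add_mulVec, dotProduct_add, smul_mulVec, dotProduct_smul, vecMulVec_mulVec]
        simp [dotProduct_comm x v]
        left
        ring
      rw [hexp]
      by_cases hcn : 0 ≤ c
      · positivity
      push Not at hcn
      have cs : ∀ τ : ℝ, 0 ≤ x ⬝ᵥ M *ᵥ x - 2 * τ * (v ⬝ᵥ x) + τ ^ 2 * q := by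
        intro τ
        have h := hM.posSemidef.dotProduct_mulVec_nonneg (x - τ • w)
        simp only [star_trivial] at h
        have hwM : w ⬝ᵥ M *ᵥ x = v ⬝ᵥ x := by
          rw [dotProduct_mulVec, ← Matrix.mulVec_transpose, hMs, hMw]
        rw [mulVec_sub, mulVec_smul, hMw, dotProduct_sub, sub_dotProduct, sub_dotProduct,
          smul_dotProduct, dotProduct_smul, smul_dotProduct, dotProduct_smul, hwM,
          dotProduct_comm x v, dotProduct_comm w v, ← hq] at h
        simp only [smul_eq_mul] at h
        linarith
      have h := cs (-c * (v ⬝ᵥ x))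
      have hf : x ⬝ᵥ M *ᵥ x - 2 * (-c * (v ⬝ᵥ x)) * (v ⬝ᵥ x) + (-c * (v ⬝ᵥ x)) ^ 2 * q
        = x ⬝ᵥ M *ᵥ x + c * (v ⬝ᵥ x) ^ 2 + c * (v ⬝ᵥ x) ^ 2 * (1 + c * q) := by ring
      rw [hf] at h
      by_cases hvx : v ⬝ᵥ x = 0
      · simpa [hvx] using hpos
      · have h1 : 0 < (v ⬝ᵥ x) ^ 2 := by positivity
        have h2 : 0 < (-c) * ((v ⬝ᵥ x) ^ 2 * (1 + c * q)) := by
          have : 0 < -c := by linarith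
          positivity
        linarith
  · have hinv : (M + c • vecMulVec v v)⁻¹ = M⁻¹ - (c / (1 + c * q)) • vecMulVec w w := by
      apply Matrix.inv_eq_right_inv
      rw [Matrix.add_mul, Matrix.mul_sub, Matrix.mul_sub, mul_nonsing_inv _ hu,
        Matrix.mul_smul, Matrix.mul_vecMulVec, hMw, Matrix.smul_mul, Matrix.vecMulVec_mul, hvM,
        Matrix.smul_mul, Matrix.mul_smul, Matrix.vecMulVec_mul_vecMulVec]
      rw [← hq]
      ext i j
      simp [Matrix.vecMulVec_apply]
      field_simp
      ring
    rw [hinv, trace_sub, trace_smul, trace_vecMulVec]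
    have : v ⬝ᵥ (M⁻¹ * M⁻¹) *ᵥ v = w ⬝ᵥ w := by
      rw [← mulVec_mulVec, dotProduct_mulVec, hvM]
    rw [this, smul_eq_mul]
    ring

lemma quad_expand (B : Matrix (Fin D) (Fin D) ℝ) (v : Fin D → ℝ) :
    v ⬝ᵥ B *ᵥ v = ∑ i, ∑ j, B i j * (v i * v j) := by
  simp only [dotProduct, mulVec, Finset.mul_sum]
  refine Finset.sum_congr rfl fun i _ => Finset.sum_congr rfl fun j _ => ?_
  ring

lemma quad_integrable {Ω : Type} [MeasurableSpace Ω] {μ : Measure Ω} {v : Ω → Fin D → ℝ}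
    (hint : ∀ i j, Integrable (fun t => v t i * v t j) μ) (B : Matrix (Fin D) (Fin D) ℝ) :
    Integrable (fun t => v t ⬝ᵥ B *ᵥ v t) μ := by
  simp only [quad_expand]
  exact integrable_finsetSum _ fun i _ => integrable_finsetSum _ fun j _ =>
    (hint i j).const_mul _

lemma quad_integral {Ω : Type} [MeasurableSpace Ω] {μ : Measure Ω} {v : Ω → Fin D → ℝ}
    (hint : ∀ i j, Integrable (fun t => v t i * v t j) μ)
    (horth : ∀ i j, ∫ t, v t i * v t j ∂μ = if i = j then 1 else 0)
    (B : Matrix (Fin D) (Fin D) ℝ) :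
    ∫ t, v t ⬝ᵥ B *ᵥ v t ∂μ = B.trace := by
  simp only [quad_expand]
  rw [integral_finsetSum _ fun i _ => integrable_finsetSum _ fun j _ =>
    (hint i j).const_mul (B i j)]
  simp only [Matrix.trace, Matrix.diag]
  refine Finset.sum_congr rfl fun i _ => ?_
  rw [integral_finsetSum _ fun j _ => (hint i j).const_mul (B i j)]
  simp [integral_const_mul, horth]

lemma step [NeZero D] {Ω : Type} [MeasurableSpace Ω] {μ : Measure Ω} {v : Ω → Fin D → ℝ}
    (hint : ∀ i j, Integrable (fun t => v t i * v t j) μ)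
    (horth : ∀ i j, ∫ t, v t i * v t j ∂μ = if i = j then 1 else 0)
    {P : Ω → Prop} (hP : ∀ᵐ t ∂μ, P t) (A : Matrix (Fin D) (Fin D) ℝ)
    (u l δ εU εL : ℝ) (hδ : 0 < δ) (hεL : εL < 1) (hpar : 1 / δ + εU < 1 - εL)
    (hu : (u • (1 : Matrix (Fin D) (Fin D) ℝ) - A).PosDef)
    (hl : (A - l • (1 : Matrix (Fin D) (Fin D) ℝ)).PosDef)
    (hU : (u • (1 : Matrix (Fin D) (Fin D) ℝ) - A)⁻¹.trace ≤ εU)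
    (hL : (A - l • (1 : Matrix (Fin D) (Fin D) ℝ))⁻¹.trace ≤ εL) :
    ∃ (t : Ω) (s : ℝ), P t ∧ 0 < s ∧
      ((u + δ) • (1 : Matrix (Fin D) (Fin D) ℝ) - (A + s • vecMulVec (v t) (v t))).PosDef ∧
      ((A + s • vecMulVec (v t) (v t)) - (l + 1) • (1 : Matrix (Fin D) (Fin D) ℝ)).PosDef ∧
      ((u + δ) • (1 : Matrix (Fin D) (Fin D) ℝ) - (A + s • vecMulVec (v t) (v t)))⁻¹.trace ≤ εU ∧
      ((A + s • vecMulVec (v t) (v t)) - (l + 1) • (1 : Matrix (Fin D) (Fin D) ℝ))⁻¹.trace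
        ≤ εL := by
  obtain ⟨hM, hMt, hM2⟩ := upper_spec _ hu δ hδ
  obtain ⟨hN, hNt, hN2⟩ := lower_spec _ hl (hL.trans_lt hεL)
  have eU : ∀ w : Fin D → ℝ, ∀ s : ℝ,
      (u + δ) • (1 : Matrix (Fin D) (Fin D) ℝ) - (A + s • vecMulVec w w)
      = (u • (1 : Matrix (Fin D) (Fin D) ℝ) - A + δ • (1 : Matrix (Fin D) (Fin D) ℝ))
        + (-s) • vecMulVec w w := by
    intro w s
    module
  have eL : ∀ w : Fin D → ℝ, ∀ s : ℝ,
      (A + s • vecMulVec w w) - (l + 1) • (1 : Matrix (Fin D) (Fin D) ℝ)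
      = (A - l • (1 : Matrix (Fin D) (Fin D) ℝ) + (-1 : ℝ) • (1 : Matrix (Fin D) (Fin D) ℝ))
        + s • vecMulVec w w := by
    intro w s
    module
  simp only [eU, eL]
  set M := u • (1 : Matrix (Fin D) (Fin D) ℝ) - A + δ • (1 : Matrix (Fin D) (Fin D) ℝ)
  set N := A - l • (1 : Matrix (Fin D) (Fin D) ℝ) + (-1 : ℝ) • (1 : Matrix (Fin D) (Fin D) ℝ)
  set ΔU := (u • (1 : Matrix (Fin D) (Fin D) ℝ) - A)⁻¹.trace - M⁻¹.trace with hΔU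
  set ΔL := N⁻¹.trace - (A - l • (1 : Matrix (Fin D) (Fin D) ℝ))⁻¹.trace with hΔL
  have pU : 0 < ΔU := by linarith
  have pL : 0 < ΔL := by linarith
  set F : Ω → ℝ := fun t =>
    ((v t ⬝ᵥ (N⁻¹ * N⁻¹) *ᵥ v t) / ΔL - v t ⬝ᵥ N⁻¹ *ᵥ v t) -
    ((v t ⬝ᵥ (M⁻¹ * M⁻¹) *ᵥ v t) / ΔU + v t ⬝ᵥ M⁻¹ *ᵥ v t) with hF
  have i1 := (quad_integrable hint (N⁻¹ * N⁻¹)).div_const ΔL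
  have i2 := quad_integrable hint N⁻¹
  have i3 := (quad_integrable hint (M⁻¹ * M⁻¹)).div_const ΔU
  have i4 := quad_integrable hint M⁻¹
  have hFint : ∫ t, F t ∂μ = ((N⁻¹ * N⁻¹).trace / ΔL - N⁻¹.trace) -
      ((M⁻¹ * M⁻¹).trace / ΔU + M⁻¹.trace) := by
    have i12 : Integrable (fun t => (v t ⬝ᵥ (N⁻¹ * N⁻¹) *ᵥ v t) / ΔL - v t ⬝ᵥ N⁻¹ *ᵥ v t) μ :=
      i1.sub i2
    have i34 : Integrable (fun t => (v t ⬝ᵥ (M⁻¹ * M⁻¹) *ᵥ v t) / ΔU + v t ⬝ᵥ M⁻¹ *ᵥ v t) μ :=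
      i3.add i4
    simp only [hF]
    rw [integral_sub i12 i34, integral_sub i1 i2, integral_add i3 i4,
      integral_div, integral_div, quad_integral hint horth, quad_integral hint horth,
      quad_integral hint horth, quad_integral hint horth]
  have hpos : 0 < ∫ t, F t ∂μ := by
    rw [hFint]
    have h1 : 1 + ΔL ≤ (N⁻¹ * N⁻¹).trace / ΔL := by
      rw [le_div_iff₀ pL]
      linarith
    have h2 : (M⁻¹ * M⁻¹).trace / ΔU ≤ 1 / δ := by
      rw [div_le_div_iff₀ pU hδ]
      linarith
    linarith
  have hex : ∃ t, P t ∧ 0 < F t := by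
    by_contra hcon
    push Not at hcon
    have : ∫ t, F t ∂μ ≤ 0 := integral_nonpos_of_ae (by
      filter_upwards [hP] with t ht
      exact hcon t ht)
    linarith
  obtain ⟨t, hPt, hFt⟩ := hex
  simp only [hF] at hFt
  set w := v t
  have qM1 : 0 ≤ w ⬝ᵥ M⁻¹ *ᵥ w := by
    simpa using hM.inv.posSemidef.dotProduct_mulVec_nonneg w
  have qN1 : 0 ≤ w ⬝ᵥ N⁻¹ *ᵥ w := by
    simpa using hN.inv.posSemidef.dotProduct_mulVec_nonneg w
  have qM2 : 0 ≤ w ⬝ᵥ (M⁻¹ * M⁻¹) *ᵥ w := by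
    have hs : M⁻¹ᵀ = M⁻¹ := by
      have := hM.inv.1
      simpa [Matrix.IsHermitian] using this
    rw [← mulVec_mulVec, dotProduct_mulVec, ← Matrix.mulVec_transpose, hs]
    simpa using dotProduct_star_self_nonneg (M⁻¹ *ᵥ w)
  set a := w ⬝ᵥ M⁻¹ *ᵥ w
  set a2 := w ⬝ᵥ (M⁻¹ * M⁻¹) *ᵥ w
  set b := w ⬝ᵥ N⁻¹ *ᵥ w
  set b2 := w ⬝ᵥ (N⁻¹ * N⁻¹) *ᵥ w
  set L := b2 / ΔL - b with hLd
  have ha2 : 0 ≤ a2 / ΔU := div_nonneg qM2 pU.le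
  have hLpos : 0 < L := by linarith
  have hLa : 0 < L - a - a2 / ΔU := by linarith
  have hLa' : 0 < L - a := by linarith
  have hsU : 0 < 1 + (-L⁻¹) * a := by
    have : 1 + (-L⁻¹) * a = (L - a) / L := by field_simp; ring
    rw [this]; positivity
  have hsL : 0 < 1 + L⁻¹ * b := by positivity
  obtain ⟨r1, r2⟩ := rank_one M hM w (-L⁻¹) hsU
  obtain ⟨r3, r4⟩ := rank_one N hN w (L⁻¹) hsL
  refine ⟨t, L⁻¹, hPt, by positivity, r1, r3, ?_, ?_⟩
  · rw [r2]
    have e : -L⁻¹ * a2 / (1 + -L⁻¹ * a) = - (a2 / (L - a)) := by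
      have : L - a ≠ 0 := hLa'.ne'
      have h3 : 1 + (-L⁻¹) * a = (L - a) / L := by field_simp; ring
      rw [h3]
      field_simp
    have : a2 / (L - a) ≤ ΔU := by
      rw [div_le_iff₀ hLa']
      have : a2 / ΔU ≤ L - a := by linarith
      rw [div_le_iff₀ pU] at this
      linarith
    change M⁻¹.trace - -L⁻¹ * a2 / (1 + -L⁻¹ * a) ≤ εU
    rw [e]
    linarith
  · rw [r4]
    change N⁻¹.trace - L⁻¹ * b2 / (1 + L⁻¹ * b) ≤ εL
    have hLb : L + b = b2 / ΔL := by rw [hLd]; ring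
    have hb2 : 0 < b2 / ΔL := by linarith
    have hb2' : b2 ≠ 0 := by
      intro h
      rw [h] at hb2
      simp at hb2
    have e : L⁻¹ * b2 / (1 + L⁻¹ * b) = ΔL := by
      have h3 : 1 + L⁻¹ * b = (L + b) / L := by field_simp
      rw [h3, hLb]
      field_simp
    rw [e]
    linarith

lemma trace_inv_smul_one (c : ℝ) (hc : c ≠ 0) :
    (c • (1 : Matrix (Fin D) (Fin D) ℝ))⁻¹.trace = D / c := by
  have : (c • (1 : Matrix (Fin D) (Fin D) ℝ))⁻¹ = c⁻¹ • 1 := by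
    apply Matrix.inv_eq_right_inv
    simp [hc]
  rw [this]
  simp
  field_simp

lemma iterate [NeZero D] {Ω : Type} [MeasurableSpace Ω] {μ : Measure Ω} {v : Ω → Fin D → ℝ}
    (hint : ∀ i j, Integrable (fun t => v t i * v t j) μ)
    (horth : ∀ i j, ∫ t, v t i * v t j ∂μ = if i = j then 1 else 0)
    {P : Ω → Prop} (hP : ∀ᵐ t ∂μ, P t)
    (δ εU εL : ℝ) (hδ : 0 < δ) (hεU : 0 < εU) (hεL0 : 0 < εL) (hεL : εL < 1)
    (hpar : 1 / δ + εU < 1 - εL) (n : ℕ) :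
    ∃ (t : Fin n → Ω) (s : Fin n → ℝ), (∀ j, P (t j)) ∧ (∀ j, 0 < s j) ∧
      ((D / εU + n * δ) • (1 : Matrix (Fin D) (Fin D) ℝ)
        - ∑ j, s j • vecMulVec (v (t j)) (v (t j))).PosDef ∧
      (∑ j, s j • vecMulVec (v (t j)) (v (t j))
        - (-(D / εL) + n) • (1 : Matrix (Fin D) (Fin D) ℝ)).PosDef ∧
      ((D / εU + n * δ) • (1 : Matrix (Fin D) (Fin D) ℝ)
        - ∑ j, s j • vecMulVec (v (t j)) (v (t j)))⁻¹.trace ≤ εU ∧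
      (∑ j, s j • vecMulVec (v (t j)) (v (t j))
        - (-(D / εL) + n) • (1 : Matrix (Fin D) (Fin D) ℝ))⁻¹.trace ≤ εL := by
  have hD : (0 : ℝ) < D := by
    exact_mod_cast Nat.pos_of_ne_zero (NeZero.ne D)
  induction n with
  | zero =>
    have c1 : 0 < D / εU := by positivity
    have c2 : 0 < D / εL := by positivity
    refine ⟨Fin.elim0, Fin.elim0, fun j => j.elim0, fun j => j.elim0, ?_, ?_, ?_, ?_⟩
    · simpa using Matrix.PosDef.one.smul c1
    · simpa using Matrix.PosDef.one.smul c2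
    · simp only [Finset.univ_eq_empty, Finset.sum_empty, sub_zero, Nat.cast_zero, zero_mul,
        add_zero]
      rw [trace_inv_smul_one _ c1.ne']
      apply le_of_eq
      field_simp
    · simp only [Finset.univ_eq_empty, Finset.sum_empty, zero_sub, Nat.cast_zero,
        add_zero, neg_smul, neg_neg]
      rw [trace_inv_smul_one _ c2.ne']
      apply le_of_eq
      field_simp
  | succ n ih =>
    obtain ⟨t, s, h1, h2, h3, h4, h5, h6⟩ := ih
    obtain ⟨t', s', g1, g2, g3, g4, g5, g6⟩ :=
      step hint horth hP _ _ _ δ εU εL hδ hεL hpar h3 h4 h5 h6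
    have e1 : D / εU + ((n + 1 : ℕ) : ℝ) * δ = D / εU + n * δ + δ := by push_cast; ring
    have e2 : -(D / εL) + ((n + 1 : ℕ) : ℝ) = -(D / εL) + n + 1 := by push_cast; ring
    refine ⟨Fin.snoc t t', Fin.snoc s s', ?_, ?_, ?_⟩
    · intro j
      refine Fin.lastCases ?_ (fun j => ?_) j
      · simpa using g1
      · simpa using h1 j
    · intro j
      refine Fin.lastCases ?_ (fun j => ?_) j
      · simpa using g2
      · simpa using h2 j
    · rw [e1, e2, Fin.sum_univ_castSucc]
      simp only [Fin.snoc_castSucc, Fin.snoc_last]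
      exact ⟨g3, g4, g5, g6⟩

lemma quad_sum {n : ℕ} (s : Fin n → ℝ) (w : Fin n → Fin D → ℝ) (c : Fin D → ℝ) :
    c ⬝ᵥ (∑ j, s j • vecMulVec (w j) (w j)) *ᵥ c = ∑ j, s j * (∑ i, c i * w j i) ^ 2 := by
  rw [Matrix.sum_mulVec, dotProduct_sum]
  refine Finset.sum_congr rfl fun j _ => ?_
  rw [smul_mulVec, dotProduct_smul, vecMulVec_mulVec]
  have : w j ⬝ᵥ c = ∑ i, c i * w j i := by
    rw [dotProduct_comm]; rfl
  have h2 : c ⬝ᵥ w j = ∑ i, c i * w j i := rfl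
  simp [this, h2]
  left
  ring

theorem sparsify (hD0 : 0 < D) {Ω : Type} [MeasurableSpace Ω] {μ : Measure Ω} {v : Ω → Fin D → ℝ}
    (hint : ∀ i j, Integrable (fun t => v t i * v t j) μ)
    (horth : ∀ i j, ∫ t, v t i * v t j ∂μ = if i = j then 1 else 0)
    {P : Ω → Prop} (hP : ∀ᵐ t ∂μ, P t) (r : ℕ) (hr : 2 ≤ r) :
    ∃ (t : Fin (r ^ 2 * D) → Ω) (s : Fin (r ^ 2 * D) → ℝ), (∀ j, P (t j)) ∧ (∀ j, 0 ≤ s j) ∧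
      ∀ c : Fin D → ℝ,
        ∑ i, c i ^ 2 ≤ ∑ j, s j * (∑ i, c i * v (t j) i) ^ 2 ∧
        ∑ j, s j * (∑ i, c i * v (t j) i) ^ 2 ≤
          ((r + 1) * (r + 2) / (r - 1) ^ 2 : ℝ) * ∑ i, c i ^ 2 := by
  have : NeZero D := ⟨hD0.ne'⟩
  have hr' : (2 : ℝ) ≤ r := by exact_mod_cast hr
  have hr1 : (0 : ℝ) < r - 1 := by linarith
  have hr0 : (0 : ℝ) < r := by linarith
  have hD : (0 : ℝ) < D := by exact_mod_cast hD0
  obtain ⟨t, s, h1, h2, h3, h4, -, -⟩ := iterate hint horth hP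
    ((r + 1) / (r - 1) : ℝ) ((r - 1) / (2 * r * (r + 1)) : ℝ) (1 / r) (by positivity)
    (by positivity) (by positivity) (by rw [div_lt_one hr0]; linarith)
    (by
      have : (1 - 1 / r : ℝ) - (1 / ((r + 1) / (r - 1)) + (r - 1) / (2 * r * (r + 1)))
        = (r - 1) / (2 * r * (r + 1)) := by
        field_simp
        ring
      have h : (0 : ℝ) < (r - 1) / (2 * r * (r + 1)) := by positivity
      linarith) (r ^ 2 * D)
  have hl0 : (0 : ℝ) < D * r * (r - 1) := by positivity
  have key : ∀ c : Fin D → ℝ, (D * r * (r - 1)) * ∑ i, c i ^ 2 ≤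
        ∑ j, s j * (∑ i, c i * v (t j) i) ^ 2 ∧
        ∑ j, s j * (∑ i, c i * v (t j) i) ^ 2 ≤
          (D * r * (r + 1) * (r + 2) / (r - 1)) * ∑ i, c i ^ 2 := by
    intro c
    have a1 := h3.posSemidef.dotProduct_mulVec_nonneg c
    have a2 := h4.posSemidef.dotProduct_mulVec_nonneg c
    have hcc : c ⬝ᵥ c = ∑ i, c i ^ 2 := by
      simp [dotProduct, sq]
    simp only [star_trivial, sub_mulVec, dotProduct_sub, smul_mulVec, one_mulVec,
      dotProduct_smul, smul_eq_mul, hcc] at a1 a2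
    rw [quad_sum] at a1 a2
    have e1 : (D / ((r - 1) / (2 * r * (r + 1))) + ((r ^ 2 * D : ℕ) : ℝ) * ((r + 1) / (r - 1)) : ℝ)
      = D * r * (r + 1) * (r + 2) / (r - 1) := by
      push_cast
      field_simp
      ring
    have e2 : (-(D / (1 / r)) + ((r ^ 2 * D : ℕ) : ℝ) : ℝ) = D * r * (r - 1) := by
      push_cast
      field_simp
      ring
    rw [e1] at a1
    rw [e2] at a2
    constructor <;> linarith
  refine ⟨t, fun j => s j / (D * r * (r - 1)), h1, fun j => div_nonneg (h2 j).le hl0.le, ?_⟩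
  intro c
  have e : ∑ j, s j / (D * r * (r - 1)) * (∑ i, c i * v (t j) i) ^ 2
    = (∑ j, s j * (∑ i, c i * v (t j) i) ^ 2) / (D * r * (r - 1)) := by
    rw [Finset.sum_div]
    refine Finset.sum_congr rfl fun j _ => ?_
    ring
  rw [e, le_div_iff₀ hl0, div_le_iff₀ hl0]
  obtain ⟨k1, k2⟩ := key c
  refine ⟨by linarith, k2.trans (le_of_eq ?_)⟩
  field_simp

lemma dim_bound (k m : ℕ) (hm : 0 < m) (hk : 2 * m ≤ k) :
    (((k + m - 1).choose m : ℕ) : ℝ) ≤ (5 * k / m : ℝ) ^ m := by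
  have h1 := Nat.choose_le_pow_div (α := ℝ) m (k + m - 1)
  have hm' : (0 : ℝ) < m := by exact_mod_cast hm
  have hk' : (2 * m : ℝ) ≤ k := by exact_mod_cast hk
  have h2 : ((k + m - 1 : ℕ) : ℝ) ≤ 3 / 2 * k := by
    have : k + m - 1 ≤ k + m := Nat.sub_le _ _
    have : ((k + m - 1 : ℕ) : ℝ) ≤ k + m := by exact_mod_cast this
    linarith
  have h3 := Real.pow_div_factorial_le_exp (m : ℝ) hm'.le m
  have h4 : Real.exp m ≤ 3 ^ m := by
    rw [← Real.exp_one_pow]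
    exact pow_le_pow_left₀ (Real.exp_pos _).le Real.exp_one_lt_three.le m
  have hf : (0 : ℝ) < m.factorial := by exact_mod_cast Nat.factorial_pos m
  have h5 : (m : ℝ) ^ m ≤ 3 ^ m * m.factorial := by
    rw [div_le_iff₀ hf] at h3
    exact h3.trans (mul_le_mul_of_nonneg_right h4 hf.le)
  refine h1.trans ?_
  rw [div_pow, div_le_div_iff₀ hf (by positivity)]
  calc ((k + m - 1 : ℕ) : ℝ) ^ m * (m : ℝ) ^ m
      ≤ (3 / 2 * k) ^ m * (3 ^ m * m.factorial) := by gcongr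
    _ = (9 / 2 * k) ^ m * m.factorial := by
        rw [← mul_assoc, ← mul_pow]; ring
    _ ≤ (5 * k) ^ m * m.factorial := by
        gcongr
        norm_num

lemma memLp_prod {Ω : Type} [MeasurableSpace Ω] {μ : Measure Ω} {k : ℕ} {p : ℝ≥0∞}
    (f : Fin k → Ω → ℝ) (hf : ∀ i, MemLp (f i) p μ) (s : Multiset (Fin k)) :
    MemLp (fun t => (s.map (fun i => f i t)).prod) ((s.card : ℝ≥0∞) * p⁻¹)⁻¹ μ := by
  induction s using Multiset.induction with
  | empty =>
    simpa using memLp_top_const (1 : ℝ)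
  | cons a s ih =>
    have : HolderTriple p ((s.card : ℝ≥0∞) * p⁻¹)⁻¹
      (((a ::ₘ s).card : ℝ≥0∞) * p⁻¹)⁻¹ := by
      constructor
      rw [inv_inv, inv_inv]
      simp [add_mul, add_comm]
    have h := MemLp.mul (r := (((a ::ₘ s).card : ℝ≥0∞) * p⁻¹)⁻¹) ih (hf a)
    simp only [Multiset.map_cons, Multiset.prod_cons]
    exact h

lemma norm_pow_eq {Ω : Type} [MeasurableSpace Ω] {μ : Measure Ω} {p : ℕ} (hp : 0 < p)
    (x : Lp ℝ (p : ℝ≥0∞) μ) : ‖x‖ ^ p = ∫ t, |x t| ^ p ∂μ := by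
  have hp0 : (p : ℝ≥0∞) ≠ 0 := by exact_mod_cast hp.ne'
  have hpr : (p : ℝ) ≠ 0 := by exact_mod_cast hp.ne'
  rw [Lp.norm_def, (Lp.memLp x).eLpNorm_eq_integral_rpow_norm hp0 (by simp)]
  have hnn : 0 ≤ ∫ t, |x t| ^ p ∂μ := integral_nonneg fun t => by positivity
  simp only [ENNReal.toReal_natCast, Real.rpow_natCast, Real.norm_eq_abs]
  rw [ENNReal.toReal_ofReal (by positivity), ← Real.rpow_natCast, ← Real.rpow_mul hnn,
    inv_mul_cancel₀ hpr, Real.rpow_one]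

lemma coe_sum_smul {Ω : Type} [MeasurableSpace Ω] {μ : Measure Ω} {p : ℝ≥0∞} {n : ℕ}
    (c : Fin n → ℝ) (F : Fin n → Lp ℝ p μ) :
    ∀ᵐ t ∂μ, (∑ i, c i • F i : Lp ℝ p μ) t = ∑ i, c i * F i t := by
  have h1 := Lp.coeFn_finsetSum Finset.univ (fun i => c i • F i)
  have h2 : ∀ᵐ t ∂μ, ∀ i, (c i • F i : Lp ℝ p μ) t = c i * F i t := by
    rw [ae_all_iff]
    intro i
    filter_upwards [Lp.coeFn_smul (c i) (F i)] with t ht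
    simpa using ht
  filter_upwards [h1, h2] with t h1 h2
  rw [h1]
  simp [h2]

lemma integral_sq_sum {D : ℕ} {Ω : Type} [MeasurableSpace Ω] {μ : Measure Ω} {v : Ω → Fin D → ℝ}
    (hint : ∀ i j, Integrable (fun t => v t i * v t j) μ)
    (horth : ∀ i j, ∫ t, v t i * v t j ∂μ = if i = j then 1 else 0) (c : Fin D → ℝ) :
    ∫ t, (∑ i, c i * v t i) ^ 2 ∂μ = ∑ i, c i ^ 2 := by
  have h := quad_integral hint horth (vecMulVec c c)
  rw [trace_vecMulVec] at h
  have e : ∀ t, (∑ i, c i * v t i) ^ 2 = v t ⬝ᵥ vecMulVec c c *ᵥ v t := by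
    intro t
    rw [quad_expand, sq, Finset.sum_mul_sum]
    refine Finset.sum_congr rfl fun i _ => Finset.sum_congr rfl fun j _ => ?_
    rw [vecMulVec_apply]
    ring
  simp only [e, h]
  simp [dotProduct, sq]

lemma exists_onb {E : Type*} [NormedAddCommGroup E] [InnerProductSpace ℝ E] (V : Submodule ℝ E)
    [FiniteDimensional ℝ V] :
    ∃ φ : Fin (Module.finrank ℝ V) → E,
      (∀ i j, inner ℝ (φ i) (φ j) = if i = j then (1 : ℝ) else 0) ∧
      ∀ g ∈ V, ∃ c : Fin (Module.finrank ℝ V) → ℝ, g = ∑ i, c i • φ i := by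
  refine ⟨fun i => (stdOrthonormalBasis ℝ V i : E), ?_, ?_⟩
  · intro i j
    exact orthonormal_iff_ite.1 (stdOrthonormalBasis ℝ V).orthonormal i j
  · intro g hg
    refine ⟨fun i => (stdOrthonormalBasis ℝ V).repr ⟨g, hg⟩ i, ?_⟩
    have := congrArg (Subtype.val) ((stdOrthonormalBasis ℝ V).sum_repr ⟨g, hg⟩)
    refine this.symm.trans ?_
    rw [Submodule.coe_sum]
    rfl

/-- Reduction: the degree-`m` powers live in a low-dimensional subspace of `L₂`. -/
lemma exists_system {Ω : Type} [MeasurableSpace Ω] {μ : Measure Ω} {k m : ℕ} (hm : 0 < m)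
    (f : Fin k → Ω → ℝ) (hf : ∀ i, MemLp (f i) ((2 * m : ℕ) : ℝ≥0∞) μ) :
    ∃ (D : ℕ) (v : Ω → Fin D → ℝ) (c : (Fin k → ℝ) → Fin D → ℝ),
      D ≤ (k + m - 1).choose m ∧
      (∀ i j, Integrable (fun t => v t i * v t j) μ) ∧
      (∀ i j, ∫ t, v t i * v t j ∂μ = if i = j then 1 else 0) ∧
      ∀ᵐ t ∂μ, ∀ a : Fin k → ℝ, (∑ j, a j * f j t) ^ m = ∑ i, c a i * v t i := by
  classical
  have hexp : ((m : ℝ≥0∞) * ((2 * m : ℕ) : ℝ≥0∞)⁻¹)⁻¹ = 2 := by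
    have h0 : (m : ℝ≥0∞) ≠ 0 := by exact_mod_cast hm.ne'
    have ht : (m : ℝ≥0∞) ≠ ∞ := by simp
    push_cast
    rw [ENNReal.mul_inv (Or.inl h0) (Or.inl ht), inv_inv, mul_comm (2 : ℝ≥0∞), ← mul_assoc,
      ENNReal.inv_mul_cancel h0 ht, one_mul]
  have hg : ∀ α : Sym (Fin k) m, MemLp (fun t => (α.1.map (fun i => f i t)).prod) 2 μ := by
    intro α
    have := memLp_prod f hf α.1
    rwa [α.2, hexp] at this
  set G : Sym (Fin k) m → Lp ℝ 2 μ := fun α => (hg α).toLp with hG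
  set V := Submodule.span ℝ (Set.range G) with hV
  have : FiniteDimensional ℝ V := FiniteDimensional.span_of_finite ℝ (Set.finite_range G)
  have hGV : ∀ α, G α ∈ V := fun α => Submodule.subset_span ⟨α, rfl⟩
  obtain ⟨φ, hφ, hC⟩ := exists_onb V
  choose C hC using fun α => hC (G α) (hGV α)
  refine ⟨Module.finrank ℝ V, fun t i => φ i t, fun a i => ∑ α : Sym (Fin k) m,
    (α.1.countPerms : ℝ) * (α.1.map a).prod * C α i, ?_, ?_, ?_, ?_⟩
  · have h := finrank_range_le_card (R := ℝ) G
    rw [Sym.card_sym_eq_choose, Fintype.card_fin] at h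
    exact h
  · intro i j
    refine (L2.integrable_inner (𝕜 := ℝ) (φ j) (φ i)).congr
      (Filter.Eventually.of_forall fun t => ?_)
    rfl
  · intro i j
    have h2 := hφ i j
    rw [L2.inner_def] at h2
    rw [← h2]
    refine integral_congr_ae (Filter.Eventually.of_forall fun t => ?_)
    exact mul_comm _ _
  · have hmon : ∀ᵐ t ∂μ, ∀ α : Sym (Fin k) m,
        (α.1.map (fun i => f i t)).prod = ∑ i, C α i * φ i t := by
      rw [ae_all_iff]
      intro α
      have e : G α = ∑ i, C α i • φ i := hC α
      have h1 := (hg α).coeFn_toLp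
      have h2 := coe_sum_smul (C α) φ
      rw [← e] at h2
      filter_upwards [h1, h2] with t h1 h2
      rw [← h2, ← h1]
    filter_upwards [hmon] with t ht
    intro a
    rw [Finset.sum_pow]
    have hs : (Finset.univ : Finset (Fin k)).sym m = Finset.univ := Finset.sym_univ m
    rw [hs]
    have h1 : ∀ α : Sym (Fin k) m, (α.1.map (fun j => a j * f j t)).prod =
        (α.1.map a).prod * ∑ i, C α i * φ i t := by
      intro α
      rw [Multiset.prod_map_mul, ht α]
    have h2 : ∀ α : Sym (Fin k) m, (α.1.countPerms : ℝ) * (α.1.map (fun j => a j * f j t)).prod =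
        ∑ i, (α.1.countPerms : ℝ) * (α.1.map a).prod * C α i * φ i t := by
      intro α
      rw [h1, ← mul_assoc, Finset.mul_sum]
      refine Finset.sum_congr rfl fun i _ => by ring
    refine (Finset.sum_congr rfl fun α _ => h2 α).trans ?_
    rw [Finset.sum_comm]
    refine Finset.sum_congr rfl fun i _ => ?_
    rw [Finset.sum_mul]

end BSS

/-- There is a universal constant `C > 0` with the following property.  Let `p` be a
positive even integer, let `k ≥ p`, let `0 < ε < 1`, and let `X` be a
`k`-dimensional subspace of a space `L_p(μ)` over a measure space `(Ω, μ)`.  Then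
there exist a positive integer `n ≤ C ε⁻² (10 k / p)^{p/2}` and a linear map
`T : X → ℓ_p^n` with `‖x‖_{L_p} ≤ ‖T x‖_p ≤ (1 + ε) ‖x‖_{L_p}` for all `x ∈ X`;
i.e. `X` `(1+ε)`-embeds in `ℓ_p^n` for `n = O(ε⁻² (10 k / p)^{p/2})`. -/
theorem subspace_Lp_embeds_in_lpn_tight :
    ∃ C : ℝ, 0 < C ∧
      ∀ (p k : ℕ), Even p → 0 < p → p ≤ k →
        ∀ (ε : ℝ), 0 < ε → ε < 1 →
          ∀ (Ω : Type) (_ : MeasurableSpace Ω) (μ : Measure Ω)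
            (X : Submodule ℝ (Lp ℝ (p : ℝ≥0∞) μ)),
            Module.finrank ℝ X = k →
            ∃ n : ℕ, 0 < n ∧
              (n : ℝ) ≤ C * ε⁻¹ ^ 2 * (10 * k / p : ℝ) ^ (p / 2) ∧
              ∃ T : X →ₗ[ℝ] (Fin n → ℝ),
                ∀ x : X,
                  ‖(x : Lp ℝ (p : ℝ≥0∞) μ)‖ ≤ (∑ i, |T x i| ^ p) ^ ((1 : ℝ) / p) ∧
                  (∑ i, |T x i| ^ p) ^ ((1 : ℝ) / p) ≤
                    (1 + ε) * ‖(x : Lp ℝ (p : ℝ≥0∞) μ)‖ := by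
  refine ⟨25, by norm_num, ?_⟩
  intro p k hpe hp hpk ε hε hε1 Ω _ μ X hX
  obtain ⟨m, hpm⟩ := hpe
  have hpm2 : p = 2 * m := by omega
  have hm : 0 < m := by omega
  have hp2 : p / 2 = m := by omega
  have hk0 : 0 < k := by omega
  have hfin : Module.Finite ℝ X := Module.finite_of_finrank_pos (by omega)
  let b := Module.finBasisOfFinrankEq ℝ X hX
  let f : Fin k → Ω → ℝ := fun j => ((b j : Lp ℝ (p : ℝ≥0∞) μ) : Ω → ℝ)
  have hf : ∀ i, MemLp (f i) ((2 * m : ℕ) : ℝ≥0∞) μ := by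
    intro i
    rw [← hpm2]
    exact Lp.memLp _
  obtain ⟨D, v, c, hD, hint, horth, hP⟩ := BSS.exists_system hm f hf
  have hpow : ∀ y : ℝ, |y| ^ p = (y ^ m) ^ 2 := by
    intro y
    rw [hpm2, mul_comm 2 m, pow_mul, ← abs_pow, sq_abs]
  -- the norm formula
  have hnorm : ∀ x : X, ‖(x : Lp ℝ (p : ℝ≥0∞) μ)‖ ^ p = ∑ i, c (b.repr x) i ^ 2 := by
    intro x
    rw [BSS.norm_pow_eq hp, ← BSS.integral_sq_sum hint horth]
    have e : (x : Lp ℝ (p : ℝ≥0∞) μ) = ∑ j, b.repr x j • (b j : Lp ℝ (p : ℝ≥0∞) μ) := by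
      have := congrArg (Subtype.val) (b.sum_repr x)
      refine this.symm.trans ?_
      rw [Submodule.coe_sum]
      rfl
    have h2 := BSS.coe_sum_smul (fun j => b.repr x j) (fun j => (b j : Lp ℝ (p : ℝ≥0∞) μ))
    rw [← e] at h2
    apply integral_congr_ae
    filter_upwards [hP, h2] with t h1 h2
    rw [← h1 (b.repr x), h2, hpow]
  have hD0 : 0 < D := by
    rcases Nat.eq_zero_or_pos D with h | h
    · subst h
      have h1 := hnorm (b ⟨0, hk0⟩)
      simp only [Finset.univ_eq_empty, Finset.sum_empty] at h1
      have h2 := eq_zero_of_pow_eq_zero h1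
      have : Fact (1 ≤ (p : ℝ≥0∞)) := ⟨by exact_mod_cast hp⟩
      rw [norm_eq_zero] at h2
      exact absurd (Subtype.ext h2) (b.ne_zero _)
    · exact h
  -- choice of the parameter
  set r := ⌈4 / ε⌉₊ with hrdef
  have hr1 : 4 / ε ≤ (r : ℝ) := Nat.le_ceil _
  have hr2 : (r : ℝ) < 4 / ε + 1 := Nat.ceil_lt_add_one (by positivity)
  have hεr : 4 ≤ r * ε := by rwa [div_le_iff₀ hε] at hr1
  have hεr2 : r * ε ≤ 5 := by
    have : (r : ℝ) * ε ≤ (4 / ε + 1) * ε := by gcongr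
    have h : (4 / ε + 1) * ε = 4 + ε := by field_simp
    linarith
  have hr4 : (4 : ℝ) ≤ r := by
    have : (r : ℝ) * ε ≤ r * 1 := by gcongr
    linarith
  have hr : 2 ≤ r := by
    have : (2 : ℝ) ≤ r := by linarith
    exact_mod_cast this
  obtain ⟨t, s, hPt, hs, hmain⟩ := BSS.sparsify hD0 hint horth hP r hr
  have hp0 : (p : ℝ) ≠ 0 := by exact_mod_cast hp.ne'
  refine ⟨r ^ 2 * D, by positivity, ?_, ?_⟩
  · rw [hp2]
    have h1 : (D : ℝ) ≤ (5 * k / m : ℝ) ^ m :=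
      le_trans (by exact_mod_cast hD) (BSS.dim_bound k m hm (by omega))
    have h2 : (10 * k / p : ℝ) = 5 * k / m := by
      have : (m : ℝ) ≠ 0 := by exact_mod_cast hm.ne'
      rw [hpm2]
      push_cast
      field_simp
      norm_num
    rw [h2]
    push_cast
    have h3 : (r : ℝ) ^ 2 ≤ 25 * ε⁻¹ ^ 2 := by
      have : (r : ℝ) ≤ 5 * ε⁻¹ := by
        rw [← div_eq_mul_inv, le_div_iff₀ hε]
        exact hεr2
      calc (r : ℝ) ^ 2 ≤ (5 * ε⁻¹) ^ 2 := by gcongr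
        _ = _ := by ring
    gcongr
  · let T : X →ₗ[ℝ] (Fin (r ^ 2 * D) → ℝ) :=
      { toFun := fun x j => s j ^ ((1 : ℝ) / p) * ∑ i, b.repr x i * f i (t j)
        map_add' := by
          intro x y
          ext j
          simp [add_mul, Finset.sum_add_distrib, mul_add]
        map_smul' := by
          intro a x
          ext j
          simp only [map_smul, Finsupp.smul_apply, smul_eq_mul, RingHom.id_apply, Pi.smul_apply,
            Finset.mul_sum]
          refine Finset.sum_congr rfl fun i _ => by ring }
    refine ⟨T, fun x => ?_⟩
    have hT : ∑ j, |T x j| ^ p = ∑ j, s j * (∑ i, c (b.repr x) i * v (t j) i) ^ 2 := by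
      refine Finset.sum_congr rfl fun j _ => ?_
      change |s j ^ ((1 : ℝ) / p) * ∑ i, b.repr x i * f i (t j)| ^ p = _
      rw [abs_mul, mul_pow, abs_of_nonneg (Real.rpow_nonneg (hs j) _), ← Real.rpow_natCast,
        ← Real.rpow_mul (hs j), one_div, inv_mul_cancel₀ hp0, Real.rpow_one,
        ← hPt j (b.repr x)]
      congr 1
      exact hpow _
    obtain ⟨g1, g2⟩ := hmain (c (b.repr x))
    rw [← hT, ← hnorm x] at g1 g2
    set S := ∑ j, |T x j| ^ p
    set N := ‖(x : Lp ℝ (p : ℝ≥0∞) μ)‖ with hN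
    have hN0 : 0 ≤ N := by
      rw [hN, Lp.norm_def]
      exact ENNReal.toReal_nonneg
    have hS0 : 0 ≤ S := le_trans (by positivity) g1
    have hR : ((r + 1) * (r + 2) / (r - 1) ^ 2 : ℝ) ≤ (1 + ε) ^ p := by
      have hr0 : (0 : ℝ) < r - 1 := by linarith
      calc ((r + 1) * (r + 2) / (r - 1) ^ 2 : ℝ) ≤ (1 + ε) ^ 2 := by
            rw [div_le_iff₀ (by positivity), ← mul_pow]
            have : (r + 2 : ℝ) ≤ (1 + ε) * (r - 1) := by nlinarith
            calc ((r + 1) * (r + 2) : ℝ) ≤ (r + 2) ^ 2 := by nlinarith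
              _ ≤ _ := by gcongr
        _ ≤ (1 + ε) ^ p := pow_le_pow_right₀ (by linarith) (by omega)
    have g3 : S ≤ ((1 + ε) * N) ^ p := by
      rw [mul_pow]
      exact g2.trans (mul_le_mul_of_nonneg_right hR (by positivity))
    have root : ∀ y : ℝ, 0 ≤ y → (y ^ p) ^ ((1 : ℝ) / p) = y := by
      intro y hy
      rw [one_div]
      exact Real.pow_rpow_inv_natCast hy hp.ne'
    constructor
    · calc N = (N ^ p) ^ ((1 : ℝ) / p) := (root N hN0).symm
        _ ≤ _ := by gcongr
    · calc S ^ ((1 : ℝ) / p) ≤ (((1 + ε) * N) ^ p) ^ ((1 : ℝ) / p) := by gcongr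
        _ = _ := root _ (by positivity)
end

section
/- There is a universal constant c > 0 with the following property. Let p be a positive even integer, let 0 < ε < 1, let n be a positive integer, and let k be a positive integer with p ≤ k and k ≤ c ε^{4/p} p n^{2/p}. Then every k-dimensional linear subspace X of a space L_p(μ) over a measure space (Ω, μ) admits a linear map T : X → ℓ_p^n with ∥x∥_{L_p} ≤ ∥Tx∥_p ≤ (1+ε) ∥x∥_{L_p} for all x ∈ X; that is, X (1+ε)-embeds in ℓ_p^n. -/
open MeasureTheory ENNReal

section BSS
open Matrix
variable {ι : Type*} [Fintype ι] [DecidableEq ι]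

lemma bss_cs {M : Matrix ι ι ℝ} (hM : M.PosDef) (v x : ι → ℝ) :
    (v ⬝ᵥ x) ^ 2 ≤ (v ⬝ᵥ M⁻¹ *ᵥ v) * (x ⬝ᵥ M *ᵥ x) := by
  have hu : IsUnit M.det := hM.isUnit.map Matrix.detMonoidHom
  have hsym : Mᵀ = M := by simpa using hM.isHermitian.eq
  set y := M⁻¹ *ᵥ v with hy
  have hMy : M *ᵥ y = v := by
    rw [hy, mulVec_mulVec, Matrix.mul_nonsing_inv _ hu, one_mulVec]
  have hyx : y ⬝ᵥ M *ᵥ x = v ⬝ᵥ x := by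
    rw [dotProduct_mulVec, ← mulVec_transpose, hsym, hMy]
  have hq : ∀ s : ℝ, 0 ≤ (v ⬝ᵥ y) * (s * s) + (-2 * (v ⬝ᵥ x)) * s + x ⬝ᵥ M *ᵥ x := by
    intro s
    have := hM.posSemidef.dotProduct_mulVec_nonneg (x - s • y)
    simp only [star_trivial, mulVec_sub, mulVec_smul, hMy, sub_dotProduct, dotProduct_sub,
      smul_dotProduct, dotProduct_smul, hyx, smul_eq_mul] at this
    rw [dotProduct_comm x v, dotProduct_comm y v] at this
    linarith
  have := discrim_le_zero hq
  unfold discrim at this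
  nlinarith

lemma bss_sm {M : Matrix ι ι ℝ} (hM : M.PosDef) (v : ι → ℝ) (t : ℝ)
    (h : 0 < 1 + t * (v ⬝ᵥ M⁻¹ *ᵥ v)) :
    (M + t • vecMulVec v v).PosDef ∧
    trace (M + t • vecMulVec v v)⁻¹ =
      trace M⁻¹ - t * (v ⬝ᵥ (M⁻¹ * M⁻¹) *ᵥ v) / (1 + t * (v ⬝ᵥ M⁻¹ *ᵥ v)) := by
  have hu : IsUnit M.det := hM.isUnit.map Matrix.detMonoidHom
  have hsym : Mᵀ = M := by simpa using hM.isHermitian.eq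
  constructor
  · refine PosDef.of_dotProduct_mulVec_pos ?_ ?_
    · refine hM.isHermitian.add ?_
      simp only [IsHermitian, conjTranspose_smul, star_trivial, conjTranspose_vecMulVec]
    · intro x hx
      have h1 := hM.dotProduct_mulVec_pos hx
      have h2 := bss_cs hM v x
      simp only [star_trivial] at h1
      have h3 : star x ⬝ᵥ (M + t • vecMulVec v v) *ᵥ x = x ⬝ᵥ M *ᵥ x + t * (v ⬝ᵥ x) ^ 2 := by
        simp only [star_trivial, add_mulVec, smul_mulVec, vecMulVec_mulVec, dotProduct_add,
          dotProduct_smul, smul_eq_mul, op_smul_eq_smul]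
        rw [dotProduct_comm x v]; ring
      rw [h3]
      rcases le_or_gt 0 t with ht | ht
      · positivity
      · nlinarith
  · set R := M⁻¹ with hR
    set a := v ⬝ᵥ R *ᵥ v with ha
    have hMR : M * R = 1 := Matrix.mul_nonsing_inv _ hu
    have hinv : (M + t • vecMulVec v v)⁻¹ =
        R - (t / (1 + t * a)) • (R * vecMulVec v v * R) := by
      apply inv_eq_right_inv
      have e1 : vecMulVec v v * (R * vecMulVec v v * R) = a • (vecMulVec v v * R) := by
        rw [← Matrix.mul_assoc, ← Matrix.mul_assoc, ← Matrix.smul_mul]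
        congr 1
        rw [vecMulVec_mul, vecMulVec_mul_vecMulVec, ← dotProduct_mulVec, ← ha, vecMulVec_smul]
      have e2 : M * (R * vecMulVec v v * R) = vecMulVec v v * R := by
        rw [← Matrix.mul_assoc, ← Matrix.mul_assoc, hMR, Matrix.one_mul]
      rw [Matrix.add_mul, Matrix.mul_sub, Matrix.mul_sub, hMR, Matrix.mul_smul, e2,
        Matrix.smul_mul, Matrix.smul_mul, Matrix.mul_smul, e1]
      have : t - t / (1 + t * a) - t * (t / (1 + t * a)) * a = 0 := by
        field_simp; ring
      have e3 : (t - t / (1 + t * a) - t * (t / (1 + t * a)) * a) • (vecMulVec v v * R) = 0 := by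
        rw [this, zero_smul]
      rw [sub_smul, sub_smul, mul_smul, mul_smul] at e3
      rw [← sub_eq_zero, ← e3]
      abel
    rw [hinv, trace_sub, trace_smul, Matrix.mul_assoc, trace_mul_comm, Matrix.mul_assoc,
      vecMulVec_mul, trace_vecMulVec, dotProduct_comm, ← dotProduct_mulVec, smul_eq_mul]
    ring

lemma bss_spec {A : Matrix ι ι ℝ} (hA : A.IsHermitian) :
    ∃ l : ι → ℝ, (∀ c : ℝ, (A + c • (1 : Matrix ι ι ℝ)).PosDef ↔ ∀ i, 0 < l i + c) ∧
      ∀ c : ℝ, (∀ i, 0 < l i + c) → trace (A + c • (1 : Matrix ι ι ℝ))⁻¹ = ∑ i, (l i + c)⁻¹ ∧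
        trace ((A + c • (1 : Matrix ι ι ℝ))⁻¹ * (A + c • (1 : Matrix ι ι ℝ))⁻¹)
          = ∑ i, ((l i + c)⁻¹) ^ 2 := by
  set U : Matrix ι ι ℝ := (hA.eigenvectorUnitary).1 with hU
  have hUU : U * Uᴴ = 1 := by
    have := (Matrix.mem_unitaryGroup_iff).1 hA.eigenvectorUnitary.2
    simpa [star_eq_conjTranspose] using this
  have hUU' : Uᴴ * U = 1 := by
    have := (Matrix.mem_unitaryGroup_iff').1 hA.eigenvectorUnitary.2
    simpa [star_eq_conjTranspose] using this
  set l := hA.eigenvalues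
  have hs : A = U * diagonal l * Uᴴ := by
    have := hA.spectral_theorem
    rw [Unitary.conjStarAlgAut_apply] at this
    simpa [star_eq_conjTranspose] using this
  have hc : ∀ c : ℝ, A + c • (1 : Matrix ι ι ℝ) = U * diagonal (fun i => l i + c) * Uᴴ := by
    intro c
    have : diagonal (fun i => l i + c) = diagonal l + c • (1 : Matrix ι ι ℝ) := by
      rw [← diagonal_one, ← diagonal_smul, diagonal_add]; simp
    rw [this, Matrix.mul_add, Matrix.add_mul, ← hs]
    rw [Matrix.mul_smul, Matrix.mul_one, Matrix.smul_mul, hUU]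
  refine ⟨l, ?_, ?_⟩
  · intro c
    have hu : IsUnit U := ⟨⟨U, Uᴴ, hUU, hUU'⟩, rfl⟩
    rw [hc, ← star_eq_conjTranspose, Matrix.IsUnit.posDef_star_right_conjugate_iff hu,
      posDef_diagonal_iff]
  · intro c hl
    have hinv : (A + c • (1 : Matrix ι ι ℝ))⁻¹ = U * diagonal (fun i => (l i + c)⁻¹) * Uᴴ := by
      apply inv_eq_right_inv
      rw [hc]
      calc _ = U * diagonal (fun i => l i + c) * (Uᴴ * U) * diagonal (fun i => (l i + c)⁻¹) * Uᴴ := by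
            simp only [Matrix.mul_assoc]
        _ = U * (diagonal (fun i => l i + c) * diagonal (fun i => (l i + c)⁻¹)) * Uᴴ := by
            rw [hUU', Matrix.mul_one]; simp only [Matrix.mul_assoc]
        _ = 1 := by
            rw [diagonal_mul_diagonal]
            have : (fun i => (l i + c) * (l i + c)⁻¹) = fun _ => (1 : ℝ) := by
              funext i; exact mul_inv_cancel₀ (hl i).ne'
            rw [this, diagonal_one, Matrix.mul_one, hUU]
    have htr : ∀ d : ι → ℝ, trace (U * diagonal d * Uᴴ) = ∑ i, d i := by
      intro d
      rw [Matrix.mul_assoc, trace_mul_comm, Matrix.mul_assoc, hUU', Matrix.mul_one, trace_diagonal]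
    constructor
    · rw [hinv, htr]
    · rw [hinv]
      have : U * diagonal (fun i => (l i + c)⁻¹) * Uᴴ * (U * diagonal (fun i => (l i + c)⁻¹) * Uᴴ)
          = U * diagonal (fun i => ((l i + c)⁻¹) ^ 2) * Uᴴ := by
        calc _ = U * diagonal (fun i => (l i + c)⁻¹) * (Uᴴ * U) * diagonal (fun i => (l i + c)⁻¹) * Uᴴ := by
              simp only [Matrix.mul_assoc]
          _ = U * (diagonal (fun i => (l i + c)⁻¹) * diagonal (fun i => (l i + c)⁻¹)) * Uᴴ := by
              rw [hUU', Matrix.mul_one]; simp only [Matrix.mul_assoc]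
          _ = _ := by
              rw [diagonal_mul_diagonal]; simp only [pow_two]
      rw [this, htr]

lemma bss_upper [Nonempty ι] {M : Matrix ι ι ℝ} (hM : M.PosDef) {δ η : ℝ} (hδ : 0 < δ)
    (hη : trace M⁻¹ ≤ η) :
    ∃ B : Matrix ι ι ℝ, trace B ≤ 1 / δ + η ∧ (∀ v, 0 ≤ v ⬝ᵥ B *ᵥ v) ∧
      ∀ v (t : ℝ), 0 < t → v ⬝ᵥ B *ᵥ v < 1 / t →
        (M + δ • (1 : Matrix ι ι ℝ) + (-t) • vecMulVec v v).PosDef ∧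
        trace (M + δ • (1 : Matrix ι ι ℝ) + (-t) • vecMulVec v v)⁻¹ ≤ η := by
  obtain ⟨l, h1, h2⟩ := bss_spec hM.isHermitian
  have hl0 : ∀ i, 0 < l i + 0 := (h1 0).1 (by simpa using hM)
  have hlp : ∀ i, 0 < l i := by simpa using hl0
  have hld : ∀ i, 0 < l i + δ := fun i => by linarith [hlp i]
  have hM1 := (h1 δ).2 hld
  obtain ⟨t0, -⟩ := h2 0 hl0
  obtain ⟨t1, t2⟩ := h2 δ hld
  simp only [zero_smul, add_zero] at t0
  set M1 := M + δ • (1 : Matrix ι ι ℝ) with hM1d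
  set R := M1⁻¹ with hR
  have hterm : ∀ i, δ * ((l i + δ)⁻¹) ^ 2 < (l i)⁻¹ - (l i + δ)⁻¹ := by
    intro i
    have a := hlp i
    have b := hld i
    have : (l i)⁻¹ - (l i + δ)⁻¹ - δ * ((l i + δ)⁻¹) ^ 2 = δ ^ 2 / (l i * (l i + δ) ^ 2) := by
      field_simp; ring
    have : 0 < δ ^ 2 / (l i * (l i + δ) ^ 2) := by positivity
    linarith
  have hΔ : δ * trace (R * R) < trace M⁻¹ - trace R := by
    rw [t0, t1, t2, Finset.mul_sum, ← Finset.sum_sub_distrib]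
    exact Finset.sum_lt_sum_of_nonempty Finset.univ_nonempty (fun i _ => hterm i)
  have hRR0 : 0 ≤ trace (R * R) := by rw [t2]; positivity
  set Δ := trace M⁻¹ - trace R with hΔd
  have hΔ0 : 0 < Δ := by nlinarith
  have hRpd : R.PosDef := hM1.inv
  have hRsym : Rᴴ = R := hRpd.isHermitian.eq
  have hq0 : ∀ v : ι → ℝ, 0 ≤ v ⬝ᵥ (R * R) *ᵥ v := by
    intro v
    have := (posSemidef_conjTranspose_mul_self R).dotProduct_mulVec_nonneg v
    rw [hRsym] at this
    simpa using this
  have ha0 : ∀ v : ι → ℝ, 0 ≤ v ⬝ᵥ R *ᵥ v := by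
    intro v
    simpa using hRpd.posSemidef.dotProduct_mulVec_nonneg v
  have hB : ∀ v : ι → ℝ, v ⬝ᵥ (Δ⁻¹ • (R * R) + R) *ᵥ v
      = (v ⬝ᵥ (R * R) *ᵥ v) / Δ + v ⬝ᵥ R *ᵥ v := by
    intro v
    simp only [add_mulVec, smul_mulVec, dotProduct_add, dotProduct_smul, smul_eq_mul]
    ring
  refine ⟨Δ⁻¹ • (R * R) + R, ?_, ?_, ?_⟩
  · rw [trace_add, trace_smul, smul_eq_mul]
    have : Δ⁻¹ * trace (R * R) ≤ 1 / δ := by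
      rw [inv_mul_eq_div, div_le_div_iff₀ hΔ0 hδ]; linarith
    have : δ * trace (R * R) ≥ 0 := by positivity
    linarith
  · intro v
    rw [hB]
    have := hq0 v
    have := ha0 v
    positivity
  · intro v t ht hv
    rw [hB] at hv
    have hq := hq0 v
    have ha := ha0 v
    set q := v ⬝ᵥ (R * R) *ᵥ v
    set a := v ⬝ᵥ R *ᵥ v with had
    have h3 : q / Δ * t + a * t < 1 := by
      rw [lt_div_iff₀ ht] at hv; linarith
    have h5 : 0 ≤ q / Δ := by positivity
    have h4 : 0 < 1 + (-t) * a := by nlinarith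
    obtain ⟨p1, p2⟩ := bss_sm hM1 v (-t) h4
    refine ⟨p1, ?_⟩
    rw [p2]
    have : - (-t * q / (1 + -t * a)) ≤ Δ := by
      rw [neg_mul, neg_div, neg_neg, div_le_iff₀ h4]
      have : q = q / Δ * Δ := by field_simp
      nlinarith
    linarith

lemma bss_lower [Nonempty ι] {N : Matrix ι ι ℝ} (hN : N.PosDef) {δ η : ℝ} (hδ : 0 < δ)
    (hη : trace N⁻¹ ≤ η) (hηδ : η * δ < 1) :
    ∃ B : Matrix ι ι ℝ, 1 / δ - η ≤ trace B ∧
      ∀ v (t : ℝ), 0 < t → 1 / t ≤ v ⬝ᵥ B *ᵥ v →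
        (N + (-δ) • (1 : Matrix ι ι ℝ) + t • vecMulVec v v).PosDef ∧
        trace (N + (-δ) • (1 : Matrix ι ι ℝ) + t • vecMulVec v v)⁻¹ ≤ η := by
  obtain ⟨l, h1, h2⟩ := bss_spec hN.isHermitian
  have hl0 : ∀ i, 0 < l i + 0 := (h1 0).1 (by simpa using hN)
  have hlp : ∀ i, 0 < l i := by simpa using hl0
  obtain ⟨t0, -⟩ := h2 0 hl0
  simp only [zero_smul, add_zero] at t0
  have hld : ∀ i, 0 < l i + -δ := fun i => by
    have h5 : (l i)⁻¹ ≤ ∑ i, (l i)⁻¹ :=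
      Finset.single_le_sum (f := fun i => (l i)⁻¹) (fun i _ => (inv_pos.2 (hlp i)).le)
        (Finset.mem_univ i)
    have h6 : (l i)⁻¹ * δ < 1 := by
      have : (l i)⁻¹ ≤ η := by linarith
      nlinarith
    rw [inv_mul_lt_iff₀ (hlp i)] at h6
    linarith
  have hN1 := (h1 (-δ)).2 hld
  obtain ⟨t1, t2⟩ := h2 (-δ) hld
  set N1 := N + (-δ) • (1 : Matrix ι ι ℝ) with hM1d
  set R := N1⁻¹ with hR
  set Δ := trace R - trace N⁻¹ with hΔd
  have hterm : ∀ i, 0 < (l i + -δ)⁻¹ - (l i)⁻¹ := by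
    intro i
    have a := hlp i
    have b := hld i
    have : (l i + -δ)⁻¹ - (l i)⁻¹ = δ / (l i * (l i + -δ)) := by
      field_simp; ring
    rw [this]; positivity
  have hΔs : Δ = ∑ i, ((l i + -δ)⁻¹ - (l i)⁻¹) := by
    rw [hΔd, t0, t1, ← Finset.sum_sub_distrib]
  have hΔ0 : 0 < Δ := by
    rw [hΔs]
    exact Finset.sum_pos (fun i _ => hterm i) Finset.univ_nonempty
  -- the key inequality
  have hCS : Δ ^ 2 ≤ (∑ i, (l i)⁻¹) * ∑ i, (δ ^ 2 * ((l i)⁻¹ * ((l i + -δ)⁻¹) ^ 2)) := by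
    rw [hΔs]
    apply Finset.sum_sq_le_sum_mul_sum_of_sq_le_mul
    · intro i _; exact (inv_pos.2 (hlp i)).le
    · intro i _
      have a := hlp i
      have b := hld i
      positivity
    · intro i _
      have a := hlp i
      have b := hld i
      have : (l i + -δ)⁻¹ - (l i)⁻¹ = δ * ((l i)⁻¹ * (l i + -δ)⁻¹) := by
        field_simp; ring
      rw [this]; apply le_of_eq; ring
  have hsum : δ * trace (R * R) - Δ = ∑ i, (δ ^ 2 * ((l i)⁻¹ * ((l i + -δ)⁻¹) ^ 2)) := by
    rw [t2, hΔs, Finset.mul_sum, ← Finset.sum_sub_distrib]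
    refine Finset.sum_congr rfl fun i _ => ?_
    have a := hlp i
    have b := hld i
    field_simp; ring
  have hkey : Δ * (1 / δ + Δ) ≤ trace (R * R) := by
    rw [← hsum, ← t0] at hCS
    have hpos : 0 ≤ δ * trace (R * R) - Δ := by
      rw [hsum]
      refine Finset.sum_nonneg fun i _ => ?_
      have a := hlp i
      have b := hld i
      positivity
    have h7 : δ * Δ ^ 2 ≤ δ * trace (R * R) - Δ := by
      have : trace N⁻¹ * δ ≤ 1 := by nlinarith
      nlinarith
    have : δ * (Δ * (1 / δ + Δ)) ≤ δ * trace (R * R) := by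
      have : δ * (Δ * (1 / δ + Δ)) = Δ + δ * Δ ^ 2 := by field_simp
      linarith
    exact le_of_mul_le_mul_left this hδ
  have hRpd : R.PosDef := hN1.inv
  have ha0 : ∀ v : ι → ℝ, 0 ≤ v ⬝ᵥ R *ᵥ v := by
    intro v
    simpa using hRpd.posSemidef.dotProduct_mulVec_nonneg v
  have hB : ∀ v : ι → ℝ, v ⬝ᵥ (Δ⁻¹ • (R * R) - R) *ᵥ v
      = (v ⬝ᵥ (R * R) *ᵥ v) / Δ - v ⬝ᵥ R *ᵥ v := by
    intro v
    simp only [sub_mulVec, smul_mulVec, dotProduct_sub, dotProduct_smul, smul_eq_mul]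
    ring
  refine ⟨Δ⁻¹ • (R * R) - R, ?_, ?_⟩
  · rw [trace_sub, trace_smul, smul_eq_mul]
    have : 1 / δ + Δ ≤ Δ⁻¹ * trace (R * R) := by
      rw [inv_mul_eq_div, le_div_iff₀ hΔ0]; linarith
    linarith
  · intro v t ht hv
    rw [hB] at hv
    have ha := ha0 v
    set q := v ⬝ᵥ (R * R) *ᵥ v
    set a := v ⬝ᵥ R *ᵥ v with had
    have h3 : 1 ≤ (q / Δ - a) * t := by
      rwa [div_le_iff₀ ht] at hv
    have h4 : 0 < 1 + t * a := by positivity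
    obtain ⟨p1, p2⟩ := bss_sm hN1 v t h4
    refine ⟨p1, ?_⟩
    rw [p2]
    have : Δ ≤ t * q / (1 + t * a) := by
      rw [le_div_iff₀ h4]
      have : q = q / Δ * Δ := by field_simp
      nlinarith
    linarith

lemma bss_iter_s5 [Nonempty ι] (V : Set (ι → ℝ))
    (hV : ∀ B : Matrix ι ι ℝ, 0 < trace B → ∃ v ∈ V, 0 < v ⬝ᵥ B *ᵥ v)
    {η : ℝ} (hη : 0 < η) (hη4 : η < 1 / 4) (n : ℕ) :
    ∃ (s : Fin n → ℝ) (w : Fin n → ι → ℝ), (∀ j, 0 ≤ s j) ∧ (∀ j, w j ∈ V) ∧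
      ∃ M N : Matrix ι ι ℝ,
        M = (Fintype.card ι / η + n * (1 + 4 * η)) • (1 : Matrix ι ι ℝ)
          - ∑ j, s j • vecMulVec (w j) (w j) ∧
        N = (∑ j, s j • vecMulVec (w j) (w j)) - (n - Fintype.card ι / η) • (1 : Matrix ι ι ℝ) ∧
        M.PosDef ∧ N.PosDef ∧ trace M⁻¹ ≤ η ∧ trace N⁻¹ ≤ η := by
  induction n with
  | zero =>
    have hc : (0 : ℝ) < Fintype.card ι := by exact_mod_cast Fintype.card_pos
    have hpd : ((Fintype.card ι / η : ℝ) • (1 : Matrix ι ι ℝ)).PosDef :=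
      Matrix.PosDef.one.smul (by positivity)
    have htr : trace ((Fintype.card ι / η : ℝ) • (1 : Matrix ι ι ℝ))⁻¹ = η := by
      have : ((Fintype.card ι / η : ℝ) • (1 : Matrix ι ι ℝ))⁻¹
          = (η / Fintype.card ι) • (1 : Matrix ι ι ℝ) := by
        apply inv_eq_right_inv
        rw [Matrix.smul_mul, Matrix.mul_smul, Matrix.one_mul, smul_smul]
        rw [div_mul_div_cancel₀ (by positivity)]
        rw [div_self hc.ne', one_smul]
      rw [this, trace_smul, trace_one, smul_eq_mul]
      field_simp
    refine ⟨fun _ => 0, fun _ => 0, fun _ => le_rfl, fun j => j.elim0, _, _, rfl, rfl, ?_⟩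
    simp only [Finset.univ_eq_empty, Finset.sum_empty, Nat.cast_zero, zero_mul, add_zero,
      sub_zero, zero_sub, neg_smul, neg_neg]
    exact ⟨hpd, hpd, htr.le, htr.le⟩
  | succ n ih =>
    obtain ⟨s, w, hs, hw, M, N, hMd, hNd, hM, hN, htM, htN⟩ := ih
    obtain ⟨BU, u1, u2, u3⟩ := bss_upper hM (δ := 1 + 4 * η) (by linarith) htM
    obtain ⟨BL, l1, l2⟩ := bss_lower hN (δ := 1) one_pos htN (by linarith)
    have htr : 0 < trace (BL - BU) := by
      rw [trace_sub]
      have : 1 / (1 + 4 * η) < 1 - 2 * η := by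
        rw [div_lt_iff₀ (by linarith)]; nlinarith
      norm_num at l1
      linarith
    obtain ⟨v, hvV, hv⟩ := hV _ htr
    rw [sub_mulVec, dotProduct_sub] at hv
    have hL : 0 < v ⬝ᵥ BL *ᵥ v := by linarith [u2 v]
    set t := 1 / (v ⬝ᵥ BL *ᵥ v) with ht
    have ht0 : 0 < t := by positivity
    have ht1 : 1 / t = v ⬝ᵥ BL *ᵥ v := by rw [ht, one_div_one_div]
    obtain ⟨m1, m2⟩ := u3 v t ht0 (by rw [ht1]; linarith)
    obtain ⟨n1, n2⟩ := l2 v t ht0 ht1.le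
    refine ⟨Fin.snoc s t, Fin.snoc w v, ?_, ?_, _, _, ?_, ?_, m1, n1, m2, n2⟩
    · intro j
      refine Fin.lastCases ?_ (fun j => ?_) j
      · simpa using ht0.le
      · simpa using hs j
    · intro j
      refine Fin.lastCases ?_ (fun j => ?_) j
      · simpa using hvV
      · simpa using hw j
    · rw [hMd, Fin.sum_univ_castSucc]
      simp only [Fin.snoc_castSucc, Fin.snoc_last]
      push_cast
      module
    · rw [hNd, Fin.sum_univ_castSucc]
      simp only [Fin.snoc_castSucc, Fin.snoc_last]
      push_cast
      module

lemma bss_main_s5 [Nonempty ι] (V : Set (ι → ℝ))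
    (hV : ∀ B : Matrix ι ι ℝ, 0 < trace B → ∃ v ∈ V, 0 < v ⬝ᵥ B *ᵥ v)
    {ε : ℝ} (hε : 0 < ε) (hε1 : ε < 1) (n : ℕ) (hn : 400 * Fintype.card ι ≤ ε ^ 2 * n) :
    ∃ (s : Fin n → ℝ) (w : Fin n → ι → ℝ), (∀ j, 0 ≤ s j) ∧ (∀ j, w j ∈ V) ∧
      ∀ g : ι → ℝ, g ⬝ᵥ g ≤ ∑ j, s j * (w j ⬝ᵥ g) ^ 2 ∧
        ∑ j, s j * (w j ⬝ᵥ g) ^ 2 ≤ (1 + ε) * (g ⬝ᵥ g) := by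
  obtain ⟨s, w, hs, hw, M, N, hMd, hNd, hM, hN, -, -⟩ :=
    bss_iter_s5 V hV (η := ε / 20) (by positivity) (by linarith) n
  have hc : (0 : ℝ) < Fintype.card ι := by exact_mod_cast Fintype.card_pos
  have hn0 : (0 : ℝ) < n := by
    by_contra h
    have : (n : ℝ) ≤ 0 := not_lt.1 h
    nlinarith [sq_nonneg ε]
  have hD : (Fintype.card ι : ℝ) / (ε / 20) ≤ n * (ε / 20) := by
    rw [div_le_iff₀ (by positivity)]; nlinarith
  have hexp : ∀ g : ι → ℝ, g ⬝ᵥ (∑ j, s j • vecMulVec (w j) (w j)) *ᵥ g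
      = ∑ j, s j * (w j ⬝ᵥ g) ^ 2 := by
    intro g
    rw [Matrix.sum_mulVec, dotProduct_sum]
    refine Finset.sum_congr rfl fun j _ => ?_
    simp only [smul_mulVec, vecMulVec_mulVec, dotProduct_smul, smul_eq_mul, op_smul_eq_smul]
    rw [dotProduct_comm g]; ring
  have hl : (0 : ℝ) < n * (1 - ε / 20) := mul_pos hn0 (by linarith)
  refine ⟨fun j => s j / (n * (1 - ε / 20)), w, fun j => div_nonneg (hs j) hl.le, hw, fun g => ?_⟩
  have h1 := hM.posSemidef.dotProduct_mulVec_nonneg g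
  have h2 := hN.posSemidef.dotProduct_mulVec_nonneg g
  have hg : 0 ≤ g ⬝ᵥ g := by simpa using dotProduct_star_self_nonneg g
  simp only [hMd, hNd, star_trivial, sub_mulVec, dotProduct_sub, hexp, smul_mulVec, one_mulVec,
    dotProduct_smul, smul_eq_mul] at h1 h2
  have e : ∑ j, s j / (n * (1 - ε / 20)) * (w j ⬝ᵥ g) ^ 2
      = (∑ j, s j * (w j ⬝ᵥ g) ^ 2) / (n * (1 - ε / 20)) := by
    rw [Finset.sum_div]
    refine Finset.sum_congr rfl fun j _ => ?_
    ring
  rw [e]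
  set S := ∑ j, s j * (w j ⬝ᵥ g) ^ 2
  set G := g ⬝ᵥ g
  constructor
  · rw [le_div_iff₀ hl]
    nlinarith
  · rw [div_le_iff₀ hl]
    have h3 : S ≤ (n * (ε / 20) + n * (1 + 4 * (ε / 20))) * G := by nlinarith
    have h4 : n * (ε / 20) + n * (1 + 4 * (ε / 20)) ≤ (1 + ε) * (n * (1 - ε / 20)) := by
      nlinarith [mul_pos hn0 hε]
    nlinarith
end BSS

lemma dim_count (m k n : ℕ) (hm : 0 < m) (hmk : 2 * m ≤ k) (ε : ℝ) (hε : 0 < ε)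
    (h : (k : ℝ) ≤ 1 / 4800 * ε ^ ((4 : ℝ) / ((2 * m : ℕ) : ℝ)) * ((2 * m : ℕ) : ℝ)
      * (n : ℝ) ^ ((2 : ℝ) / ((2 * m : ℕ) : ℝ))) :
    400 * (Fintype.card (Sym (Fin k) m) : ℝ) ≤ ε ^ 2 * n := by
  have hm' : (0 : ℝ) < m := by exact_mod_cast hm
  have hmk' : (2 : ℝ) * m ≤ k := by exact_mod_cast hmk
  have h1 : (Fintype.card (Sym (Fin k) m) : ℝ) ≤ (2 * k) ^ m / (m.factorial : ℝ) := by
    rw [Sym.card_sym_eq_multichoose, Nat.multichoose_eq, Fintype.card_fin]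
    refine (Nat.choose_le_pow_div m (k + m - 1)).trans ?_
    gcongr
    have : k + m - 1 ≤ 2 * k := by omega
    exact_mod_cast this
  have h2 : (m : ℝ) ^ m / m.factorial ≤ 3 ^ m := by
    refine (Real.pow_div_factorial_le_exp _ hm'.le m).trans ?_
    rw [← mul_one (m : ℝ), Real.exp_nat_mul]
    gcongr
    exact (Real.exp_one_lt_d9.trans (by norm_num)).le
  have h3 : (k : ℝ) ^ m ≤ (1 / 2400 * m) ^ m * (ε ^ 2 * n) := by
    have := pow_le_pow_left₀ (Nat.cast_nonneg k) h m
    refine this.trans (le_of_eq ?_)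
    have e1 : (ε ^ ((4 : ℝ) / ((2 * m : ℕ) : ℝ))) ^ m = ε ^ 2 := by
      rw [← Real.rpow_natCast, ← Real.rpow_mul hε.le, ← Real.rpow_natCast]
      congr 1; push_cast; field_simp; norm_num
    have e2 : ((n : ℝ) ^ ((2 : ℝ) / ((2 * m : ℕ) : ℝ))) ^ m = n := by
      rw [← Real.rpow_natCast, ← Real.rpow_mul (Nat.cast_nonneg n)]
      have : (2 : ℝ) / ((2 * m : ℕ) : ℝ) * m = 1 := by push_cast; field_simp
      rw [this, Real.rpow_one]
    rw [mul_pow, mul_pow, mul_pow, e1, e2]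
    push_cast
    rw [mul_pow, mul_pow]
    have : (1 / 4800 : ℝ) ^ m * 2 ^ m = (1 / 2400) ^ m := by rw [← mul_pow]; norm_num
    rw [← this]; ring
  have hf : (0 : ℝ) < m.factorial := by exact_mod_cast m.factorial_pos
  have hE : 0 ≤ ε ^ 2 * n := by positivity
  calc 400 * (Fintype.card (Sym (Fin k) m) : ℝ) ≤ 400 * ((2 * k) ^ m / (m.factorial : ℝ)) := by
        gcongr
    _ = 400 * (2 ^ m * k ^ m / m.factorial) := by rw [mul_pow]
    _ ≤ 400 * (2 ^ m * ((1 / 2400 * m) ^ m * (ε ^ 2 * n)) / m.factorial) := by gcongr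
    _ = 400 * (2 ^ m * (1 / 2400) ^ m * (m ^ m / m.factorial)) * (ε ^ 2 * n) := by
        rw [mul_pow]; ring
    _ ≤ 400 * (2 ^ m * (1 / 2400) ^ m * 3 ^ m) * (ε ^ 2 * n) := by gcongr
    _ = 400 * (1 / 400) ^ m * (ε ^ 2 * n) := by
        rw [← mul_pow, ← mul_pow]; norm_num
    _ ≤ 1 * (ε ^ 2 * n) := by
        gcongr
        have : (1 / 400 : ℝ) ^ m ≤ (1 / 400) ^ 1 :=
          pow_le_pow_of_le_one (by norm_num) (by norm_num) hm
        linarith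
    _ = _ := one_mul _

lemma memLp_monomial {Ω : Type*} [MeasurableSpace Ω] {μ : Measure Ω} {k m : ℕ} (hm : 0 < m)
    (b : Fin k → Ω → ℝ) (hb : ∀ i, MemLp (b i) ((2 * m : ℕ) : ℝ≥0∞) μ) (α : Sym (Fin k) m) :
    MemLp (fun ω => (α.val.map (fun i => b i ω)).prod) 2 μ := by
  obtain ⟨⟨l⟩, hl⟩ := α
  replace hl : l.length = m := by simpa using hl
  have h := MemLp.prod' (s := (Finset.univ : Finset (Fin l.length)))
    (f := fun i => b (l.get i)) (p := fun _ => ((2 * m : ℕ) : ℝ≥0∞)) (μ := μ)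
    (fun i _ => hb _)
  have e : (∑ i : Fin l.length, (((2 * m : ℕ) : ℝ≥0∞))⁻¹)⁻¹ = 2 := by
    rw [Finset.sum_const, Finset.card_univ, Fintype.card_fin, hl, nsmul_eq_mul]
    push_cast
    have e0 : ((2 : ℝ≥0∞) * m)⁻¹ = 2⁻¹ * (m : ℝ≥0∞)⁻¹ :=
      ENNReal.mul_inv (Or.inl (by norm_num)) (Or.inl (by norm_num))
    have hm0 : (m : ℝ≥0∞) ≠ 0 := by exact_mod_cast hm.ne'
    rw [e0, mul_left_comm, ENNReal.mul_inv_cancel hm0 (by simp), mul_one, inv_inv]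
  have e' : (fun ω => (Multiset.map (fun i => b i ω) (Quot.mk _ l : Multiset (Fin k))).prod) =
      fun ω => ∏ i : Fin l.length, b (l.get i) ω := by
    funext ω
    change (Multiset.map (fun i => b i ω) (l : Multiset (Fin k))).prod = _
    rw [Multiset.map_coe, Multiset.prod_coe, ← List.prod_ofFn]
    congr 1
    apply List.ext_get <;> simp
  simp only [e] at h
  rw [← e'] at h
  exact h

lemma integral_quad {Ω : Type*} [MeasurableSpace Ω] {μ : Measure Ω} {d : ℕ}
    (f : Fin d → Lp ℝ 2 μ) (hf : Orthonormal ℝ f) (B : Matrix (Fin d) (Fin d) ℝ) :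
    Integrable (fun ω => (fun i => f i ω) ⬝ᵥ B.mulVec (fun i => f i ω)) μ ∧
    ∫ ω, (fun i => f i ω) ⬝ᵥ B.mulVec (fun i => f i ω) ∂μ = B.trace := by
  have e : (fun ω => (fun i => f i ω) ⬝ᵥ B.mulVec (fun i => f i ω)) =
      fun ω => ∑ i, ∑ j, B i j * inner ℝ (f i ω) (f j ω) := by
    funext ω
    simp only [dotProduct, Matrix.mulVec, Finset.mul_sum]
    refine Finset.sum_congr rfl fun i _ => Finset.sum_congr rfl fun j _ => ?_
    simp; ring
  have hi : ∀ i j, Integrable (fun ω => B i j * inner ℝ (f i ω) (f j ω)) μ := fun i j =>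
    (L2.integrable_inner (𝕜 := ℝ) (f i) (f j)).const_mul _
  constructor
  · rw [e]
    exact integrable_finsetSum _ fun i _ => integrable_finsetSum _ fun j _ => hi i j
  · rw [e, integral_finsetSum _ fun i _ => integrable_finsetSum _ fun j _ => hi i j]
    refine Finset.sum_congr rfl fun i _ => ?_
    rw [integral_finsetSum _ fun j _ => hi i j]
    have : ∀ j, ∫ ω, B i j * inner ℝ (f i ω) (f j ω) ∂μ = if i = j then B i j else 0 := by
      intro j
      rw [integral_const_mul, ← L2.inner_def, orthonormal_iff_ite.1 hf i j]
      simp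
    simp_rw [this]
    simp

lemma sparsify {Ω : Type*} [MeasurableSpace Ω] {μ : Measure Ω} {k m : ℕ} (hm : 0 < m)
    (b : Fin k → Ω → ℝ) (hb : ∀ i, MemLp (b i) ((2 * m : ℕ) : ℝ≥0∞) μ)
    {ε : ℝ} (hε : 0 < ε) (hε1 : ε < 1) (n : ℕ)
    (hn : 400 * (Fintype.card (Sym (Fin k) m) : ℝ) ≤ ε ^ 2 * n) :
    ∃ (s : Fin n → ℝ) (y : Fin n → Fin k → ℝ), (∀ j, 0 ≤ s j) ∧ ∀ a : Fin k → ℝ,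
      ∫ ω, (∑ i, a i * b i ω) ^ (2 * m) ∂μ ≤ ∑ j, s j * (∑ i, a i * y j i) ^ (2 * m) ∧
      ∑ j, s j * (∑ i, a i * y j i) ^ (2 * m) ≤
        (1 + ε) * ∫ ω, (∑ i, a i * b i ω) ^ (2 * m) ∂μ := by
  classical
  set F : Sym (Fin k) m → Ω → ℝ := fun α ω => (α.val.map (fun i => b i ω)).prod with hF
  have hFm : ∀ α, MemLp (F α) 2 μ := memLp_monomial hm b hb
  set G : Sym (Fin k) m → Lp ℝ 2 μ := fun α => (hFm α).toLp (F α) with hG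
  set W := Submodule.span ℝ (Set.range G) with hW
  have : FiniteDimensional ℝ W := FiniteDimensional.span_of_finite ℝ (Set.finite_range G)
  set d := Module.finrank ℝ W with hd
  have hdle : d ≤ Fintype.card (Sym (Fin k) m) := finrank_range_le_card G
  set e := stdOrthonormalBasis ℝ W with he
  set f : Fin d → Lp ℝ 2 μ := fun i => (e i : Lp ℝ 2 μ) with hf
  have hfo : Orthonormal ℝ f := e.orthonormal.comp_linearIsometry W.subtypeₗᵢ
  have hGW : ∀ α, G α ∈ W := fun α => Submodule.subset_span ⟨α, rfl⟩
  set c : Sym (Fin k) m → Fin d → ℝ := fun α i => e.repr ⟨G α, hGW α⟩ i with hc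
  have hGe : ∀ α, G α = ∑ i, c α i • f i := by
    intro α
    have := congrArg (Subtype.val) (e.sum_repr ⟨G α, hGW α⟩)
    refine this.symm.trans ?_
    rw [Submodule.coe_sum]; rfl
  have hae : ∀ᵐ ω ∂μ, ∀ α, F α ω = ∑ i, c α i * f i ω := by
    rw [ae_all_iff]
    intro α
    have h1 := (hFm α).coeFn_toLp
    have h2 := Lp.coeFn_finsetSum (Finset.univ) (fun i => c α i • f i)
    have h3 : ∀ᵐ ω ∂μ, ∀ i, (c α i • f i : Lp ℝ 2 μ) ω = c α i * f i ω := by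
      rw [ae_all_iff]; intro i
      filter_upwards [Lp.coeFn_smul (c α i) (f i)] with ω h
      rw [h]; rfl
    have h4 : (hFm α).toLp (F α) = ∑ i, c α i • f i := hGe α
    rw [h4] at h1
    filter_upwards [h1, h2, h3] with ω h1 h2 h3
    rw [← h1, h2]
    simp [h3]
  set g : (Fin k → ℝ) → Fin d → ℝ := fun a i =>
    ∑ α : Sym (Fin k) m, (α.val.countPerms : ℝ) * (α.val.map a).prod * c α i with hg
  have hpow : ∀ ω, (∀ α, F α ω = ∑ i, c α i * f i ω) → ∀ a : Fin k → ℝ,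
      (∑ i, a i * b i ω) ^ m = (fun i => f i ω) ⬝ᵥ g a := by
    intro ω hω a
    rw [Finset.sum_pow, Finset.sym_univ]
    simp only [Multiset.prod_map_mul]
    simp only [dotProduct, hg, Finset.mul_sum]
    rw [Finset.sum_comm]
    refine Finset.sum_congr rfl fun α _ => ?_
    have := hω α
    simp only [hF] at this
    rw [this, Finset.mul_sum, Finset.mul_sum]
    refine Finset.sum_congr rfl fun i _ => ?_
    ring
  have hint : ∀ a : Fin k → ℝ, ∫ ω, (∑ i, a i * b i ω) ^ (2 * m) ∂μ = g a ⬝ᵥ g a := by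
    intro a
    rw [← Matrix.trace_vecMulVec, ← (integral_quad f hfo _).2]
    apply integral_congr_ae
    filter_upwards [hae] with ω hω
    rw [mul_comm, pow_mul, hpow ω hω a, Matrix.vecMulVec_mulVec]
    simp only [dotProduct_smul, smul_eq_mul, op_smul_eq_smul]
    rw [dotProduct_comm (g a), pow_two]
  rcases Nat.eq_zero_or_pos d with hd0 | hd0
  · have hz : ∀ a, g a ⬝ᵥ g a = 0 := by
      intro a
      have : IsEmpty (Fin d) := by rw [hd0]; infer_instance
      simp [dotProduct]
    refine ⟨0, 0, fun _ => le_rfl, fun a => ?_⟩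
    rw [hint, hz]
    simp
  · have : Nonempty (Fin d) := ⟨⟨0, hd0⟩⟩
    set V : Set (Fin d → ℝ) :=
      {v | ∃ ω, (∀ α, F α ω = ∑ i, c α i * f i ω) ∧ v = fun i => f i ω} with hV
    have hVB : ∀ B : Matrix (Fin d) (Fin d) ℝ, 0 < B.trace →
        ∃ v ∈ V, 0 < v ⬝ᵥ B.mulVec v := by
      intro B hB
      by_contra! hcon
      have h1 := (integral_quad f hfo B).2
      have h2 : ∫ ω, (fun i => f i ω) ⬝ᵥ B.mulVec (fun i => f i ω) ∂μ ≤ 0 := by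
        apply integral_nonpos_of_ae
        filter_upwards [hae] with ω hω
        exact hcon _ ⟨ω, hω, rfl⟩
      linarith
    obtain ⟨s, w, hs, hw, hsw⟩ := bss_main_s5 V hVB hε hε1 n (by
      rw [Fintype.card_fin]
      refine le_trans ?_ hn
      have : (d : ℝ) ≤ Fintype.card (Sym (Fin k) m) := by exact_mod_cast hdle
      linarith)
    choose ω hω hwω using hw
    refine ⟨s, fun j i => b i (ω j), hs, fun a => ?_⟩
    have heq : ∑ j, s j * (∑ i, a i * b i (ω j)) ^ (2 * m) = ∑ j, s j * (w j ⬝ᵥ g a) ^ 2 := by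
      refine Finset.sum_congr rfl fun j _ => ?_
      rw [mul_comm 2 m, pow_mul, hpow _ (hω j) a, hwω j]
    rw [hint, heq]
    exact hsw (g a)

theorem subspace_Lp_embeds_in_lpn_dim_condition :
    ∃ c : ℝ, 0 < c ∧
      ∀ (p k n : ℕ), Even p → 0 < p → p ≤ k → 0 < n →
        ∀ (ε : ℝ), 0 < ε → ε < 1 →
          (k : ℝ) ≤ c * ε ^ ((4 : ℝ) / p) * p * (n : ℝ) ^ ((2 : ℝ) / p) →
          ∀ (Ω : Type) (_ : MeasurableSpace Ω) (μ : Measure Ω)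
            (X : Submodule ℝ (Lp ℝ (p : ℝ≥0∞) μ)),
            Module.finrank ℝ X = k →
            ∃ T : X →ₗ[ℝ] (Fin n → ℝ),
              ∀ x : X,
                ‖(x : Lp ℝ (p : ℝ≥0∞) μ)‖ ≤ (∑ i, |T x i| ^ p) ^ ((1 : ℝ) / p) ∧
                (∑ i, |T x i| ^ p) ^ ((1 : ℝ) / p) ≤
                  (1 + ε) * ‖(x : Lp ℝ (p : ℝ≥0∞) μ)‖ := by
  refine ⟨1 / 4800, by norm_num, ?_⟩
  intro p k n hpe hp hpk hn ε hε hε1 hk Ω _ μ X hX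
  obtain ⟨m, rfl⟩ : ∃ m, p = 2 * m := by
    obtain ⟨m, hm⟩ := hpe; exact ⟨m, by omega⟩
  have hm : 0 < m := by omega
  have hcount := dim_count m k n hm hpk ε hε hk
  have hfd : FiniteDimensional ℝ X := Module.finite_of_finrank_pos (by omega)
  let bX := Module.finBasisOfFinrankEq ℝ X hX
  obtain ⟨s, y, hs, hsy⟩ := sparsify hm (fun i => ((bX i : Lp ℝ ((2 * m : ℕ) : ℝ≥0∞) μ) : Ω → ℝ))
    (fun i => Lp.memLp _) hε hε1 n hcount
  have hp0 : ((2 * m : ℕ) : ℝ) ≠ 0 := by exact_mod_cast hp.ne'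
  have hnorm : ∀ x : X, ‖(x : Lp ℝ ((2 * m : ℕ) : ℝ≥0∞) μ)‖ =
      (∫ ω, (∑ i, bX.repr x i * (bX i : Lp ℝ ((2 * m : ℕ) : ℝ≥0∞) μ) ω) ^ (2 * m) ∂μ)
        ^ ((1 : ℝ) / (2 * m : ℕ)) := by
    intro x
    have hx : (x : Lp ℝ ((2 * m : ℕ) : ℝ≥0∞) μ) =
        ∑ i, bX.repr x i • (bX i : Lp ℝ ((2 * m : ℕ) : ℝ≥0∞) μ) := by
      have := congrArg Subtype.val (bX.sum_repr x)
      refine this.symm.trans ?_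
      rw [Submodule.coe_sum]; rfl
    have h2 := Lp.coeFn_finsetSum (Finset.univ)
      (fun i => bX.repr x i • (bX i : Lp ℝ ((2 * m : ℕ) : ℝ≥0∞) μ))
    have h3 : ∀ᵐ ω ∂μ, ∀ i, (bX.repr x i • (bX i : Lp ℝ ((2 * m : ℕ) : ℝ≥0∞) μ) :
        Lp ℝ ((2 * m : ℕ) : ℝ≥0∞) μ) ω
        = bX.repr x i * (bX i : Lp ℝ ((2 * m : ℕ) : ℝ≥0∞) μ) ω := by
      rw [ae_all_iff]; intro i
      filter_upwards [Lp.coeFn_smul (bX.repr x i) (bX i : Lp ℝ ((2 * m : ℕ) : ℝ≥0∞) μ)] with ω h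
      rw [h]; rfl
    have h4 : ∀ᵐ ω ∂μ, (x : Lp ℝ ((2 * m : ℕ) : ℝ≥0∞) μ) ω
        = ∑ i, bX.repr x i * (bX i : Lp ℝ ((2 * m : ℕ) : ℝ≥0∞) μ) ω := by
      rw [← hx] at h2
      filter_upwards [h2, h3] with ω h2 h3
      rw [h2]; simp [h3]
    rw [Lp.norm_def, MemLp.eLpNorm_eq_integral_rpow_norm (by exact_mod_cast hp.ne')
      (ENNReal.natCast_ne_top _) (Lp.memLp _), ENNReal.toReal_ofReal (by positivity)]
    rw [ENNReal.toReal_natCast, one_div]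
    congr 1
    apply integral_congr_ae
    filter_upwards [h4] with ω h4
    rw [h4, Real.rpow_natCast, Real.norm_eq_abs, (even_two_mul m).pow_abs]
  let T : X →ₗ[ℝ] (Fin n → ℝ) := LinearMap.pi fun j =>
    (s j ^ ((1 : ℝ) / (2 * m : ℕ))) • ∑ i, y j i • (bX.coord i)
  have hT : ∀ x : X, ∑ j, |T x j| ^ (2 * m) = ∑ j, s j * (∑ i, bX.repr x i * y j i) ^ (2 * m) := by
    intro x
    refine Finset.sum_congr rfl fun j _ => ?_
    have : T x j = s j ^ ((1 : ℝ) / (2 * m : ℕ)) * ∑ i, bX.repr x i * y j i := by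
      simp [T, mul_comm]
    rw [this, (even_two_mul m).pow_abs, mul_pow, one_div, Real.rpow_inv_natCast_pow (hs j) hp.ne']
  refine ⟨T, fun x => ?_⟩
  obtain ⟨l1, l2⟩ := hsy (fun i => bX.repr x i)
  rw [hT, hnorm]
  have hI : 0 ≤ ∫ ω, (∑ i, bX.repr x i * (bX i : Lp ℝ ((2 * m : ℕ) : ℝ≥0∞) μ) ω) ^ (2 * m) ∂μ :=
    integral_nonneg fun ω => (even_two_mul m).pow_nonneg _
  constructor
  · exact Real.rpow_le_rpow hI l1 (by positivity)
  · refine (Real.rpow_le_rpow (hI.trans l1) l2 (by positivity)).trans ?_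
    rw [Real.mul_rpow (by linarith) hI]
    gcongr
    calc (1 + ε) ^ ((1 : ℝ) / (2 * m : ℕ)) ≤ (1 + ε) ^ (1 : ℝ) := by
          apply Real.rpow_le_rpow_of_exponent_le (by linarith)
          rw [div_le_one (by positivity)]
          exact_mod_cast hp
      _ = 1 + ε := Real.rpow_one _
end
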